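/- arXiv:2207.02761 — 7 statements merged into one kernel-verified Lean document; each statement's English description precedes it below -/
import Mathlib

section
/- Reproducing property of the Bargmann space: let g : ℂⁿ → ℂ be holomorphic (complex Fréchet differentiable on all of ℂⁿ) with ∫_{ℂⁿ} |g(w)|² exp(−π|w|²) dV(w) < ∞. Then for every z ∈ ℂⁿ the function w ↦ exp(π Σ_{i=1}^n z_i · conj(w_i)) · g(w) · exp(−π|w|²) is integrable on ℂⁿ and ∫_{ℂⁿ} exp(π Σ_{i=1}^n z_i · conj(w_i)) · g(w) · exp(−π|w|²) dV(w) = g(z). -/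
open MeasureTheory
open scoped Real

/-- The Gaussian weight `exp (-π |u|²)` on `ℂ^ι`. -/
noncomputable def gaussianWeight {ι : Type*} [Fintype ι] (u : ι → ℂ) : ℝ :=
  Real.exp (-π * ∑ i, ‖u i‖ ^ 2)

lemma measurableEmbedding_circle_smul {ι : Type*} (c : Circle) :
    MeasurableEmbedding (fun u : ι → ℂ => (c : ℂ) • u) :=
  measurableEmbedding_const_smul₀ c.coe_ne_zero

section

variable {ι : Type*} [Fintype ι]

lemma gaussianWeight_pos (u : ι → ℂ) : 0 < gaussianWeight u := Real.exp_pos _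

@[fun_prop]
lemma continuous_gaussianWeight : Continuous (gaussianWeight (ι := ι)) := by
  unfold gaussianWeight
  fun_prop

lemma gaussianWeight_eq_prod (u : ι → ℂ) :
    gaussianWeight u = ∏ i, Real.exp (-π * ‖u i‖ ^ 2) := by
  rw [gaussianWeight, Finset.mul_sum, Real.exp_sum]

lemma integral_exp_neg_pi_mul_sq_norm : ∫ x : ℂ, Real.exp (-π * ‖x‖ ^ 2) = 1 := by
  have h := Complex.integral_exp_neg_mul_rpow (p := 2) (b := π) (by norm_num) Real.pi_pos
  norm_num [Real.rpow_neg_one] at h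
  simpa [Real.rpow_neg_one, Real.pi_ne_zero] using h

lemma integral_gaussianWeight : ∫ u : ι → ℂ, gaussianWeight u = 1 := by
  simp_rw [gaussianWeight_eq_prod]
  rw [integral_fintype_prod_volume_eq_pow (fun x : ℂ => Real.exp (-π * ‖x‖ ^ 2)),
    integral_exp_neg_pi_mul_sq_norm, one_pow]

lemma integrable_gaussianWeight : Integrable (gaussianWeight (ι := ι)) := by
  by_contra h
  simpa [integral_undef h] using integral_gaussianWeight (ι := ι)

lemma gaussianWeight_circle_smul (c : Circle) (u : ι → ℂ) :
    gaussianWeight ((c : ℂ) • u) = gaussianWeight u := by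
  simp [gaussianWeight, Circle.norm_coe]

lemma measurePreserving_circle_smul (c : Circle) :
    MeasurePreserving (fun u : ι → ℂ => (c : ℂ) • u) :=
  volume_preserving_pi (fun _ : ι => (rotation c).measurePreserving)

/-- The mean value property of entire functions of several variables against the Gaussian
measure. -/
theorem integral_mul_gaussianWeight {F : (ι → ℂ) → ℂ} (hF : Differentiable ℂ F)
    (hint : Integrable fun u => F u * (gaussianWeight u : ℂ)) :
    ∫ u, F u * (gaussianWeight u : ℂ) = F 0 := by
  have hrot (c : Circle) (u : ι → ℂ) : F ((c : ℂ) • u) * (gaussianWeight u : ℂ) =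
      F ((c : ℂ) • u) * (gaussianWeight ((c : ℂ) • u) : ℂ) := by
    rw [gaussianWeight_circle_smul]
  have hcont := hF.continuous
  have hcircle (θ : ℝ) : circleMap 0 1 θ = (Circle.exp θ : ℂ) := by simp [circleMap]
  have hprod : Integrable (Function.uncurry fun (θ : ℝ) (u : ι → ℂ) =>
      F (circleMap 0 1 θ • u) * (gaussianWeight u : ℂ))
      ((volume.restrict (Set.uIoc 0 (2 * π))).prod volume) := by
    rw [integrable_prod_iff]
    · refine ⟨.of_forall fun θ => ?_, ?_⟩
      · simp only [Function.uncurry, hcircle, hrot]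
        exact ((measurePreserving_circle_smul _).integrable_comp_emb
          (measurableEmbedding_circle_smul _)).2 hint
      · simp only [Function.uncurry, hcircle, hrot]
        simp_rw [(measurePreserving_circle_smul _).integral_comp
          (measurableEmbedding_circle_smul _) (fun u : ι → ℂ => ‖F u * (gaussianWeight u : ℂ)‖)]
        simp only [Set.uIoc]
        exact integrable_const _
    · refine Continuous.aestronglyMeasurable ?_
      simp only [Function.uncurry_def]
      fun_prop
  have hswap := intervalIntegral_integral_swap hprod
  have hleft (θ : ℝ) : ∫ u, F (circleMap 0 1 θ • u) * (gaussianWeight u : ℂ) =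
      ∫ u, F u * (gaussianWeight u : ℂ) := by
    simp only [hcircle, hrot]
    exact (measurePreserving_circle_smul _).integral_comp
      (measurableEmbedding_circle_smul _) (fun u : ι → ℂ => F u * (gaussianWeight u : ℂ))
  have hright (u : ι → ℂ) :
      ∫ θ in 0..2 * π, F (circleMap 0 1 θ • u) * (gaussianWeight u : ℂ) =
        (2 * π : ℂ) * F 0 * (gaussianWeight u : ℂ) := by
    have hd : Differentiable ℂ fun t : ℂ => F (t • u) := by fun_prop
    have h := (hd.diffContOnCl (s := Metric.ball 0 |(1 : ℝ)|)).circleAverage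
    rw [Real.circleAverage_def, zero_smul, Complex.real_smul] at h
    rw [intervalIntegral.integral_mul_const, ← h]
    have : (π : ℂ) ≠ 0 := by simp [Real.pi_ne_zero]
    push_cast
    field_simp
  simp_rw [hleft, hright] at hswap
  rw [intervalIntegral.integral_const, integral_const_mul, integral_complex_ofReal,
    integral_gaussianWeight, Complex.real_smul] at hswap
  have : (2 * π : ℂ) ≠ 0 := by simp [Real.pi_ne_zero]
  refine mul_left_cancel₀ this ?_
  simpa using hswap

lemma sq_norm_exp_mul_gaussianWeight (z w : ι → ℂ) :
    ‖Complex.exp ((π : ℂ) * ∑ i, z i * (starRingEnd ℂ) (w i))‖ ^ 2 * gaussianWeight w =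
      Real.exp (π * ∑ i, ‖z i‖ ^ 2) * gaussianWeight (w - z) := by
  rw [Complex.norm_exp, gaussianWeight, gaussianWeight, ← Real.exp_nat_mul, ← Real.exp_add,
    ← Real.exp_add, Complex.re_ofReal_mul, Complex.re_sum]
  congr 1
  simp only [Finset.mul_sum, ← Finset.sum_add_distrib]
  refine Finset.sum_congr rfl fun i _ => ?_
  simp [Complex.sq_norm, Complex.normSq_apply]
  ring

lemma exp_mul_gaussianWeight_add (z u : ι → ℂ) :
    Complex.exp ((π : ℂ) * ∑ i, z i * (starRingEnd ℂ) ((u + z) i)) * (gaussianWeight (u + z) : ℂ) =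
      Complex.exp (-(π : ℂ) * ∑ i, (starRingEnd ℂ) (z i) * u i) * (gaussianWeight u : ℂ) := by
  simp only [gaussianWeight, Complex.ofReal_exp, ← Complex.exp_add]
  congr 1
  push_cast
  simp only [Finset.mul_sum, ← Finset.sum_add_distrib]
  refine Finset.sum_congr rfl fun i _ => ?_
  simp only [← Complex.mul_conj', Pi.add_apply, map_add]
  ring

end

theorem statement1 (n : ℕ) (hn : 1 ≤ n) (g : (Fin n → ℂ) → ℂ)
    (hg : Differentiable ℂ g)
    (hL2 : Integrable (fun w : Fin n → ℂ =>
      ‖g w‖ ^ 2 * Real.exp (-π * ∑ i, ‖w i‖ ^ 2)) volume)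
    (z : Fin n → ℂ) :
    (Integrable (fun w : Fin n → ℂ =>
        Complex.exp ((π : ℂ) * ∑ i, z i * (starRingEnd ℂ) (w i)) * g w *
          (Real.exp (-π * ∑ i, ‖w i‖ ^ 2) : ℂ)) volume) ∧
    (∫ w : Fin n → ℂ,
        Complex.exp ((π : ℂ) * ∑ i, z i * (starRingEnd ℂ) (w i)) * g w *
          (Real.exp (-π * ∑ i, ‖w i‖ ^ 2) : ℂ)) = g z := by
  have hweight (w : Fin n → ℂ) : Real.exp (-π * ∑ i, ‖w i‖ ^ 2) = gaussianWeight w := rfl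
  simp only [hweight] at hL2 ⊢
  have hcont := hg.continuous
  have hint : Integrable (fun w : Fin n → ℂ =>
      Complex.exp ((π : ℂ) * ∑ i, z i * (starRingEnd ℂ) (w i)) * g w * (gaussianWeight w : ℂ)) := by
    refine (((integrable_gaussianWeight.comp_sub_right z).const_mul
      (Real.exp (π * ∑ i, ‖z i‖ ^ 2))).add hL2).mono'
      (Continuous.aestronglyMeasurable (by fun_prop)) (.of_forall fun w => ?_)
    rw [Pi.add_apply, ← sq_norm_exp_mul_gaussianWeight, ← add_mul, norm_mul, norm_mul,
      Complex.norm_of_nonneg (gaussianWeight_pos w).le]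
    gcongr
    · exact (gaussianWeight_pos w).le
    · nlinarith [two_mul_le_add_sq ‖Complex.exp ((π : ℂ) * ∑ i, z i * (starRingEnd ℂ) (w i))‖ ‖g w‖,
        mul_nonneg (norm_nonneg (Complex.exp ((π : ℂ) * ∑ i, z i * (starRingEnd ℂ) (w i))))
          (norm_nonneg (g w))]
  refine ⟨hint, ?_⟩
  have hshift (u : Fin n → ℂ) :
      Complex.exp ((π : ℂ) * ∑ i, z i * (starRingEnd ℂ) ((u + z) i)) * g (u + z) *
          (gaussianWeight (u + z) : ℂ) =
        Complex.exp (-(π : ℂ) * ∑ i, (starRingEnd ℂ) (z i) * u i) * g (u + z) *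
          (gaussianWeight u : ℂ) := by
    rw [mul_right_comm, exp_mul_gaussianWeight_add, mul_right_comm]
  have hint' := hint.comp_add_right z
  rw [← integral_add_right_eq_self _ z]
  simp only [hshift] at hint' ⊢
  rw [integral_mul_gaussianWeight (by fun_prop) hint']
  simp
end

section
/- Idempotency of the model orthogonal Bergman kernel of order k: for all integers 0 ≤ m ≤ n, every k ∈ ℕ, and all Z, Z' ∈ ℂⁿ, the function W ↦ 𝒫^{⊥,k}_{n,m}(Z,W) · 𝒫^{⊥,k}_{n,m}(W,Z') is integrable on ℂⁿ and ∫_{ℂⁿ} 𝒫^{⊥,k}_{n,m}(Z,W) · 𝒫^{⊥,k}_{n,m}(W,Z') dV(W) = 𝒫^{⊥,k}_{n,m}(Z,Z'). -/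
open MeasureTheory
open scoped Real

/-- The model orthogonal Bergman kernel `𝒫^{⊥,k}_{n,m}` of order `k` on `ℂⁿ`, where
`n = m + q`, the first `m` coordinates are tangential (`Z_Y`) and the last `q = n - m`
coordinates are normal (`Z_N`). -/
noncomputable def modelOrthKernel (m q k : ℕ) (Z Z' : Fin (m + q) → ℂ) : ℂ :=
  Complex.exp (-(π : ℂ) / 2 *
      ((∑ i : Fin m, ((‖Z (Fin.castAdd q i)‖ : ℂ) ^ 2 + (‖Z' (Fin.castAdd q i)‖ : ℂ) ^ 2
          - 2 * Z (Fin.castAdd q i) * (starRingEnd ℂ) (Z' (Fin.castAdd q i))))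
        + ∑ j : Fin q, ((‖Z (Fin.natAdd m j)‖ : ℂ) ^ 2 + (‖Z' (Fin.natAdd m j)‖ : ℂ) ^ 2)))
    * (π : ℂ) ^ k *
    ∑ β ∈ Finset.Nat.antidiagonalTuple q k,
      (∏ j, Z (Fin.natAdd m j) ^ β j) * (∏ j, (starRingEnd ℂ) (Z' (Fin.natAdd m j)) ^ β j)
        / ((∏ j, (β j).factorial : ℕ) : ℂ)

/-- The one-variable Bergman kernel of the Bargmann–Fock space. -/
noncomputable def tangentialFactor (z z' : ℂ) : ℂ :=
  Complex.exp (-(π : ℂ) / 2 * ((‖z‖ : ℂ) ^ 2 + (‖z'‖ : ℂ) ^ 2 - 2 * z * (starRingEnd ℂ) z'))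

/-- The projection kernel onto `z ^ b * exp (-π / 2 * ‖z‖ ^ 2)`, up to the factor `π ^ b`. -/
noncomputable def normalFactor (b : ℕ) (z z' : ℂ) : ℂ :=
  Complex.exp (-(π : ℂ) / 2 * ((‖z‖ : ℂ) ^ 2 + (‖z'‖ : ℂ) ^ 2)) *
    (z ^ b * (starRingEnd ℂ) z' ^ b / (b.factorial : ℂ))

lemma modelOrthKernel_eq (m q k : ℕ) (Z Z' : Fin (m + q) → ℂ) :
    modelOrthKernel m q k Z Z' = (π : ℂ) ^ k * ∑ β ∈ Finset.Nat.antidiagonalTuple q k,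
      (∏ i, tangentialFactor (Z (Fin.castAdd q i)) (Z' (Fin.castAdd q i))) *
        ∏ j, normalFactor (β j) (Z (Fin.natAdd m j)) (Z' (Fin.natAdd m j)) := by
  rw [modelOrthKernel, mul_add, Complex.exp_add]
  simp only [tangentialFactor, normalFactor, Finset.prod_mul_distrib,
    Finset.prod_div_distrib, ← Complex.exp_sum, ← Finset.mul_sum, Nat.cast_prod, ← mul_assoc]
  ring

lemma integral_rpow_mul_exp (d : ℕ) :
    ∫ w : ℂ, ‖w‖ ^ (d : ℝ) * Real.exp (-π * ‖w‖ ^ (2 : ℝ)) =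
      π * π ^ (-((d : ℝ) + 2) / 2) * Real.Gamma (((d : ℝ) + 2) / 2) := by
  rw [Complex.integral_rpow_mul_exp_neg_mul_rpow one_le_two
    (by have := d.cast_nonneg (α := ℝ); linarith) Real.pi_pos]
  ring

lemma integrable_pow_mul_exp (d : ℕ) :
    Integrable (fun w : ℂ => ‖w‖ ^ d * Real.exp (-π * ‖w‖ ^ 2)) := by
  have h : Integrable (fun w : ℂ => ‖w‖ ^ (d : ℝ) * Real.exp (-π * ‖w‖ ^ (2 : ℝ))) := by
    refine not_imp_comm.1 integral_undef ?_
    rw [integral_rpow_mul_exp]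
    have := Real.Gamma_pos_of_pos (s := ((d : ℝ) + 2) / 2) (by positivity)
    positivity
  simpa [Real.rpow_natCast] using h

lemma integral_pow_mul_exp (b : ℕ) :
    ∫ w : ℂ, ‖w‖ ^ (2 * b) * Real.exp (-π * ‖w‖ ^ 2) = (b.factorial : ℝ) / π ^ b := by
  have h := integral_rpow_mul_exp (2 * b)
  simp only [Real.rpow_natCast, Real.rpow_two] at h
  rw [h, show (((2 * b : ℕ) : ℝ) + 2) / 2 = b + 1 by push_cast; ring, Real.Gamma_nat_eq_factorial,
    show -(((2 * b : ℕ) : ℝ) + 2) / 2 = -((b + 1 : ℕ) : ℝ) by push_cast; ring,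
    Real.rpow_neg Real.pi_pos.le, Real.rpow_natCast]
  have := Real.pi_ne_zero
  field_simp
  ring

lemma norm_conj_pow_mul_pow_mul_cexp (b c : ℕ) (w : ℂ) :
    ‖(starRingEnd ℂ) w ^ b * w ^ c * Complex.exp (-(π : ℂ) * (‖w‖ : ℂ) ^ 2)‖ =
      ‖w‖ ^ (b + c) * Real.exp (-π * ‖w‖ ^ 2) := by
  rw [norm_mul, norm_mul, norm_pow, norm_pow, RCLike.norm_conj, Complex.norm_exp, pow_add]
  norm_cast

lemma integrable_conj_pow_mul_pow_mul_cexp (b c : ℕ) :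
    Integrable (fun w : ℂ =>
      (starRingEnd ℂ) w ^ b * w ^ c * Complex.exp (-(π : ℂ) * (‖w‖ : ℂ) ^ 2)) := by
  refine (integrable_pow_mul_exp (b + c)).mono' ?_ (.of_forall fun w =>
    (norm_conj_pow_mul_pow_mul_cexp b c w).le)
  exact Continuous.aestronglyMeasurable (by fun_prop)

lemma integral_conj_pow_mul_pow_mul_cexp (b c : ℕ) :
    ∫ w : ℂ, (starRingEnd ℂ) w ^ b * w ^ c * Complex.exp (-(π : ℂ) * (‖w‖ : ℂ) ^ 2) =
      if b = c then (b.factorial : ℂ) / (π : ℂ) ^ b else 0 := by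
  split_ifs with hbc
  · subst hbc
    have h := congrArg (fun x : ℝ => (x : ℂ)) (integral_pow_mul_exp b)
    simp only [← integral_complex_ofReal] at h
    push_cast at h
    rw [← h]
    congr with w
    rw [← mul_pow, mul_comm ((starRingEnd ℂ) w), Complex.mul_conj', pow_mul]
  · set θ : ℝ := π / ((c : ℝ) - b) with hθ
    have hcb : (c : ℝ) - b ≠ 0 := sub_ne_zero.2 (by exact_mod_cast Ne.symm hbc)
    have ha : (starRingEnd ℂ) (Circle.exp θ : ℂ) ^ b * (Circle.exp θ : ℂ) ^ c = -1 := by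
      rw [Circle.coe_exp, ← Complex.exp_conj, ← Complex.exp_nat_mul, ← Complex.exp_nat_mul,
        ← Complex.exp_add, ← Complex.exp_pi_mul_I]
      have h : (π : ℂ) = θ * ((c : ℂ) - b) := by
        rw [hθ]
        exact_mod_cast (div_mul_cancel₀ π hcb).symm
      rw [h, map_mul, Complex.conj_I, Complex.conj_ofReal]
      ring_nf
    have h := integral_comp (rotation (Circle.exp θ))
      (fun w : ℂ => (starRingEnd ℂ) w ^ b * w ^ c * Complex.exp (-(π : ℂ) * (‖w‖ : ℂ) ^ 2))
    simp only [rotation_apply, map_mul, mul_pow, norm_mul, Circle.norm_coe, one_mul] at h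
    refine self_eq_neg.1 (h.symm.trans ?_)
    rw [← integral_neg]
    congr with w
    linear_combination (starRingEnd ℂ) w ^ b * w ^ c *
      Complex.exp (-(π : ℂ) * (‖w‖ : ℂ) ^ 2) * ha

lemma tangentialFactor_mul (z z' w : ℂ) :
    tangentialFactor z w * tangentialFactor w z' =
      Complex.exp (-(π : ℂ) / 2 * ((‖z‖ : ℂ) ^ 2 + (‖z'‖ : ℂ) ^ 2)) *
        Complex.exp (-(π : ℂ) * ∑ i, (Complex.measurableEquivPi w i : ℂ) ^ 2 +
          ∑ i, ![π * (z + (starRingEnd ℂ) z'), π * Complex.I * ((starRingEnd ℂ) z' - z)] i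
            * (Complex.measurableEquivPi w i : ℂ)) := by
  have hw : (starRingEnd ℂ) w = w.re - w.im * Complex.I := by
    apply Complex.ext <;> simp
  have hw' : w = w.re + w.im * Complex.I := (Complex.re_add_im w).symm
  have hn : (‖w‖ : ℂ) ^ 2 = (w.re : ℂ) ^ 2 + (w.im : ℂ) ^ 2 := by
    rw [← Complex.mul_conj', hw]
    nth_rw 1 [hw']
    linear_combination - (w.im : ℂ) ^ 2 * Complex.I_sq
  simp only [tangentialFactor, ← Complex.exp_add, Fin.sum_univ_two, Complex.measurableEquivPi_apply]
  simp only [Matrix.cons_val_zero, Matrix.cons_val_one]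
  rw [hn, hw]
  congr 1
  linear_combination π * (starRingEnd ℂ) z' * hw'

lemma integrable_tangentialFactor_mul (z z' : ℂ) :
    Integrable (fun w => tangentialFactor z w * tangentialFactor w z') := by
  simp only [tangentialFactor_mul]
  refine Integrable.const_mul ?_ _
  exact (Complex.volume_preserving_equiv_pi.integrable_comp_emb
    Complex.measurableEquivPi.measurableEmbedding).2
    (GaussianFourier.integrable_cexp_neg_mul_sum_add (b := (π : ℂ)) (by simpa using Real.pi_pos) _)

lemma integral_tangentialFactor_mul (z z' : ℂ) :
    ∫ w, tangentialFactor z w * tangentialFactor w z' = tangentialFactor z z' := by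
  simp only [tangentialFactor_mul]
  rw [integral_const_mul, Complex.volume_preserving_equiv_pi.integral_comp'
    (g := fun v : Fin 2 → ℝ => Complex.exp (-(π : ℂ) * ∑ i, (v i : ℂ) ^ 2 +
          ∑ i, ![π * (z + (starRingEnd ℂ) z'), π * Complex.I * ((starRingEnd ℂ) z' - z)] i
            * (v i : ℂ))), GaussianFourier.integral_cexp_neg_mul_sum_add (by simpa using Real.pi_pos)]
  have : (π : ℂ) ≠ 0 := by exact_mod_cast Real.pi_ne_zero
  simp only [tangentialFactor, Fin.sum_univ_two, Matrix.cons_val_zero, Matrix.cons_val_one,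
    div_self this, Complex.one_cpow, one_mul, ← Complex.exp_add]
  congr 1
  field_simp
  ring_nf
  simp
  ring

lemma normalFactor_mul (b c : ℕ) (z z' w : ℂ) :
    normalFactor b z w * normalFactor c w z' =
      Complex.exp (-(π : ℂ) / 2 * ((‖z‖ : ℂ) ^ 2 + (‖z'‖ : ℂ) ^ 2)) *
        (z ^ b * (starRingEnd ℂ) z' ^ c / (b.factorial * c.factorial : ℂ)) *
      ((starRingEnd ℂ) w ^ b * w ^ c * Complex.exp (-(π : ℂ) * (‖w‖ : ℂ) ^ 2)) := by
  have h : Complex.exp (-(π : ℂ) / 2 * ((‖z‖ : ℂ) ^ 2 + (‖w‖ : ℂ) ^ 2)) *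
      Complex.exp (-(π : ℂ) / 2 * ((‖w‖ : ℂ) ^ 2 + (‖z'‖ : ℂ) ^ 2)) =
      Complex.exp (-(π : ℂ) / 2 * ((‖z‖ : ℂ) ^ 2 + (‖z'‖ : ℂ) ^ 2)) *
      Complex.exp (-(π : ℂ) * (‖w‖ : ℂ) ^ 2) := by
    rw [← Complex.exp_add, ← Complex.exp_add]
    ring_nf
  simp only [normalFactor]
  linear_combination (z ^ b * (starRingEnd ℂ) z' ^ c / (b.factorial * c.factorial : ℂ)) *
    (starRingEnd ℂ) w ^ b * w ^ c * h

lemma integrable_normalFactor_mul (b c : ℕ) (z z' : ℂ) :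
    Integrable (fun w => normalFactor b z w * normalFactor c w z') := by
  simp only [normalFactor_mul]
  exact (integrable_conj_pow_mul_pow_mul_cexp b c).const_mul _

lemma integral_normalFactor_mul (b c : ℕ) (z z' : ℂ) :
    ∫ w, normalFactor b z w * normalFactor c w z' =
      if b = c then normalFactor b z z' / (π : ℂ) ^ b else 0 := by
  simp only [normalFactor_mul]
  rw [integral_const_mul, integral_conj_pow_mul_pow_mul_cexp]
  split_ifs with hbc
  · subst hbc
    have : (b.factorial : ℂ) ≠ 0 := by exact_mod_cast b.factorial_ne_zero
    simp only [normalFactor]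
    field_simp
  · simp

/-- The coordinate factors of the product of the `β`- and `γ`-terms of two kernels. -/
noncomputable def mixedFactor {m q : ℕ} (Z Z' : Fin (m + q) → ℂ) (β γ : Fin q → ℕ) :
    Fin (m + q) → ℂ → ℂ :=
  Fin.addCases
    (fun i w => tangentialFactor (Z (Fin.castAdd q i)) w *
      tangentialFactor w (Z' (Fin.castAdd q i)))
    (fun j w => normalFactor (β j) (Z (Fin.natAdd m j)) w *
      normalFactor (γ j) w (Z' (Fin.natAdd m j)))

lemma modelOrthKernel_mul (m q k : ℕ) (Z Z' W : Fin (m + q) → ℂ) :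
    modelOrthKernel m q k Z W * modelOrthKernel m q k W Z' =
      (π : ℂ) ^ k * (π : ℂ) ^ k * ∑ β ∈ Finset.Nat.antidiagonalTuple q k,
        ∑ γ ∈ Finset.Nat.antidiagonalTuple q k, ∏ i, mixedFactor Z Z' β γ i (W i) := by
  rw [modelOrthKernel_eq, modelOrthKernel_eq, mul_mul_mul_comm, Finset.sum_mul_sum]
  congr 1
  refine Finset.sum_congr rfl fun β _ => Finset.sum_congr rfl fun γ _ => ?_
  rw [Fin.prod_univ_add, mul_mul_mul_comm]
  simp only [mixedFactor, Fin.addCases_left, Fin.addCases_right, Finset.prod_mul_distrib]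

lemma integrable_prod_mixedFactor {m q : ℕ} (Z Z' : Fin (m + q) → ℂ) (β γ : Fin q → ℕ) :
    Integrable (fun W : Fin (m + q) → ℂ => ∏ i, mixedFactor Z Z' β γ i (W i)) := by
  refine Integrable.fintype_prod fun i => ?_
  refine Fin.addCases (fun i => ?_) (fun j => ?_) i
  · simpa only [mixedFactor, Fin.addCases_left] using integrable_tangentialFactor_mul _ _
  · simpa only [mixedFactor, Fin.addCases_right] using integrable_normalFactor_mul _ _ _ _

lemma integral_prod_mixedFactor {m q k : ℕ} (Z Z' : Fin (m + q) → ℂ) {β : Fin q → ℕ}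
    (hβ : β ∈ Finset.Nat.antidiagonalTuple q k) (γ : Fin q → ℕ) :
    ∫ W : Fin (m + q) → ℂ, ∏ i, mixedFactor Z Z' β γ i (W i) =
      if β = γ then ((∏ i, tangentialFactor (Z (Fin.castAdd q i)) (Z' (Fin.castAdd q i))) *
        ∏ j, normalFactor (β j) (Z (Fin.natAdd m j)) (Z' (Fin.natAdd m j))) / (π : ℂ) ^ k
      else 0 := by
  rw [integral_fintype_prod_volume_eq_prod, Fin.prod_univ_add]
  simp only [mixedFactor, Fin.addCases_left, Fin.addCases_right, integral_tangentialFactor_mul,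
    integral_normalFactor_mul]
  split_ifs with h
  · subst h
    simp only [if_true, Finset.prod_div_distrib, Finset.prod_pow_eq_pow_sum,
      Finset.Nat.mem_antidiagonalTuple.1 hβ, mul_div_assoc]
  · obtain ⟨j, hj⟩ := Function.ne_iff.1 h
    rw [Finset.prod_eq_zero (Finset.mem_univ j) (if_neg hj), mul_zero]

theorem statement4 (m q k : ℕ) (Z Z' : Fin (m + q) → ℂ) :
    (Integrable (fun W : Fin (m + q) → ℂ =>
        modelOrthKernel m q k Z W * modelOrthKernel m q k W Z') volume) ∧
    (∫ W : Fin (m + q) → ℂ, modelOrthKernel m q k Z W * modelOrthKernel m q k W Z') =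
      modelOrthKernel m q k Z Z' := by
  simp only [modelOrthKernel_mul]
  have hint (β γ : Fin q → ℕ) := integrable_prod_mixedFactor Z Z' β γ
  refine ⟨(integrable_finsetSum _ fun β _ => integrable_finsetSum _ fun γ _ =>
    hint β γ).const_mul _, ?_⟩
  rw [integral_const_mul, integral_finsetSum _ fun β _ => integrable_finsetSum _ fun γ _ =>
    hint β γ, modelOrthKernel_eq, mul_assoc, Finset.mul_sum]
  congr 1
  refine Finset.sum_congr rfl fun β hβ => ?_
  have hπ : (π : ℂ) ≠ 0 := by exact_mod_cast Real.pi_ne_zero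
  rw [integral_finsetSum _ fun γ _ => hint β γ,
    Finset.sum_congr rfl fun γ _ => integral_prod_mixedFactor Z Z' hβ γ, Finset.sum_ite_eq,
    if_pos hβ]
  field_simp
end

section
/- Mutual orthogonality of the model orthogonal Bergman kernels: for all integers 0 ≤ m ≤ n, all k, l ∈ ℕ with k ≠ l, and all Z, Z' ∈ ℂⁿ, the function W ↦ 𝒫^{⊥,k}_{n,m}(Z,W) · 𝒫^{⊥,l}_{n,m}(W,Z') is integrable on ℂⁿ and ∫_{ℂⁿ} 𝒫^{⊥,k}_{n,m}(Z,W) · 𝒫^{⊥,l}_{n,m}(W,Z') dV(W) = 0. -/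
open MeasureTheory
open scoped Real

lemma pow_mul_exp_le_factorial_mul_exp_neg_sq {B r : ℝ} (hr : 0 ≤ r) (n : ℕ) :
    r ^ n * Real.exp (-π * r ^ 2 + B * r) ≤
      n.factorial * Real.exp ((B + 1) ^ 2) * Real.exp (-r ^ 2) := by
  have hn : (0 : ℝ) < n.factorial := by exact_mod_cast n.factorial_pos
  have hpow : r ^ n ≤ n.factorial * Real.exp r := by
    have := Real.pow_div_factorial_le_exp r hr n
    rwa [div_le_iff₀' hn] at this
  calc r ^ n * Real.exp (-π * r ^ 2 + B * r)
      ≤ n.factorial * Real.exp r * Real.exp (-π * r ^ 2 + B * r) := by gcongr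
    _ = n.factorial * Real.exp (r + (-π * r ^ 2 + B * r)) := by rw [mul_assoc, ← Real.exp_add]
    _ ≤ n.factorial * Real.exp ((B + 1) ^ 2 + -r ^ 2) := by
        refine mul_le_mul_of_nonneg_left (Real.exp_le_exp.mpr ?_) hn.le
        nlinarith [mul_le_mul_of_nonneg_right Real.pi_gt_three.le (sq_nonneg r),
          sq_nonneg (r - (B + 1)), sq_nonneg r, sq_nonneg (B + 1)]
    _ = n.factorial * Real.exp ((B + 1) ^ 2) * Real.exp (-r ^ 2) := by
        rw [mul_assoc, ← Real.exp_add]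

/-- A Gaussian on `ℂ` times the exponential of a real-linear form and a monomial in `w` and its
conjugate. -/
noncomputable def gaussianMonomial (a b : ℂ) (j k : ℕ) (w : ℂ) : ℂ :=
  Complex.exp (-(π : ℂ) * (‖w‖ : ℂ) ^ 2 + (a * (starRingEnd ℂ) w + b * w)) *
    ((starRingEnd ℂ) w ^ j * w ^ k)

lemma norm_gaussianMonomial_le (a b : ℂ) (j k : ℕ) (w : ℂ) :
    ‖gaussianMonomial a b j k w‖ ≤
      ‖w‖ ^ (j + k) * Real.exp (-π * ‖w‖ ^ 2 + (‖a‖ + ‖b‖) * ‖w‖) := by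
  have hlin : (a * (starRingEnd ℂ) w + b * w).re ≤ (‖a‖ + ‖b‖) * ‖w‖ := by
    refine (Complex.re_le_norm _).trans ((norm_add_le _ _).trans_eq ?_)
    simp [add_mul]
  have hsq : (-(π : ℂ) * (‖w‖ : ℂ) ^ 2).re = -π * ‖w‖ ^ 2 := by
    exact_mod_cast Complex.ofReal_re (-π * ‖w‖ ^ (2 : ℕ))
  rw [gaussianMonomial, norm_mul, Complex.norm_exp, Complex.add_re, hsq, norm_mul, norm_pow,
    norm_pow, RCLike.norm_conj, ← pow_add, mul_comm]
  gcongr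

lemma integrable_gaussianMonomial (a b : ℂ) (j k : ℕ) :
    Integrable (gaussianMonomial a b j k) := by
  have hgauss : Integrable (fun w : ℂ => Real.exp (-‖w‖ ^ 2)) := by
    have h := (GaussianFourier.integrable_cexp_neg_mul_sq_norm_add (V := ℂ) (b := 1)
      (by simp) 0 0).norm
    refine h.congr (.of_forall fun w => ?_)
    have : (-(‖w‖ : ℂ) ^ 2).re = -‖w‖ ^ 2 := by
      exact_mod_cast Complex.ofReal_re (-‖w‖ ^ (2 : ℕ))
    simp [Complex.norm_exp, this]
  refine (hgauss.const_mul ((j + k).factorial * Real.exp ((‖a‖ + ‖b‖ + 1) ^ 2))).mono' ?_ ?_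
  · have : Continuous (gaussianMonomial a b j k) := by
      unfold gaussianMonomial
      fun_prop
    exact this.aestronglyMeasurable
  · exact .of_forall fun w => (norm_gaussianMonomial_le a b j k w).trans
      (pow_mul_exp_le_factorial_mul_exp_neg_sq (norm_nonneg w) _)

lemma modelOrthKernel_mul_eq_sum (m q k l : ℕ) (Z Z' W : Fin (m + q) → ℂ) :
    modelOrthKernel m q k Z W * modelOrthKernel m q l W Z' =
      ∑ β ∈ Finset.Nat.antidiagonalTuple q k, ∑ γ ∈ Finset.Nat.antidiagonalTuple q l,
        (Complex.exp (-(π : ℂ) / 2 * (∑ i, ((‖Z i‖ : ℂ) ^ 2 + (‖Z' i‖ : ℂ) ^ 2))) *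
          (π : ℂ) ^ (k + l) *
          ((∏ j, Z (Fin.natAdd m j) ^ β j) / ((∏ j, (β j).factorial : ℕ) : ℂ)) *
          ((∏ j, (starRingEnd ℂ) (Z' (Fin.natAdd m j)) ^ γ j) /
            ((∏ j, (γ j).factorial : ℕ) : ℂ))) *
        ∏ i, gaussianMonomial
          (Fin.append (fun i : Fin m => π * Z (Fin.castAdd q i)) (fun _ : Fin q => 0) i)
          (Fin.append (fun i : Fin m => π * (starRingEnd ℂ) (Z' (Fin.castAdd q i)))
            (fun _ : Fin q => 0) i)
          (Fin.append (fun _ : Fin m => 0) β i) (Fin.append (fun _ : Fin m => 0) γ i) (W i) := by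
  unfold modelOrthKernel
  rw [mul_mul_mul_comm, Finset.sum_mul_sum, Finset.mul_sum]
  refine Finset.sum_congr rfl fun β _ => ?_
  rw [Finset.mul_sum]
  refine Finset.sum_congr rfl fun γ _ => ?_
  simp only [gaussianMonomial, Finset.prod_mul_distrib, ← Complex.exp_sum, Fin.prod_univ_add,
    Fin.sum_univ_add, Fin.append_left, Fin.append_right, pow_zero, Finset.prod_const_one, one_mul,
    zero_mul, add_zero]
  have hfactor : ∀ A B C D x y p P u Q r v : ℂ, A + B = C + D →
      Complex.exp A * x * (Complex.exp B * y) * (p * P / u * (Q * r / v)) =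
        Complex.exp C * (x * y) * (p / u) * (r / v) * (Complex.exp D * (P * Q)) := by
    intro A B C D x y p P u Q r v h
    have hexp : Complex.exp A * Complex.exp B = Complex.exp C * Complex.exp D := by
      rw [← Complex.exp_add, h, Complex.exp_add]
    linear_combination (x * y * (p * P / u * (Q * r / v))) * hexp
  rw [pow_add]
  apply hfactor
  simp only [Finset.sum_add_distrib, Finset.sum_sub_distrib, mul_assoc, ← Finset.mul_sum,
    mul_comm ((starRingEnd ℂ) (Z' _))]
  ring

/-- Multiplication of the last `q` coordinates of `ℂ^(m + q)` by `c`. -/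
def scaleNormal (m q : ℕ) (c : ℂ) (W : Fin (m + q) → ℂ) : Fin (m + q) → ℂ :=
  fun i => Fin.append (fun _ : Fin m => 1) (fun _ : Fin q => c) i * W i

lemma measurePreserving_scaleNormal (m q : ℕ) (c : Circle) :
    MeasurePreserving (scaleNormal m q c) := by
  refine volume_preserving_pi fun i => ?_
  induction i using Fin.addCases with
  | left i =>
    convert MeasurePreserving.id (volume : Measure ℂ) using 1
    ext w
    simp
  | right j =>
    rw [Fin.append_right]
    exact (rotation c).measurePreserving

lemma measurableEmbedding_scaleNormal (m q : ℕ) (c : Circle) :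
    MeasurableEmbedding (scaleNormal m q c) := by
  refine (measurePreserving_scaleNormal m q c).measurable.measurableEmbedding fun W W' h => ?_
  ext i
  have hi := congrFun h i
  induction i using Fin.addCases <;> simpa [scaleNormal] using hi

lemma modelOrthKernel_scaleNormal_left (m q k : ℕ) (c : Circle) (W Z : Fin (m + q) → ℂ) :
    modelOrthKernel m q k (scaleNormal m q c W) Z = (c : ℂ) ^ k * modelOrthKernel m q k W Z := by
  simp only [modelOrthKernel, scaleNormal, Fin.append_left, Fin.append_right, one_mul, norm_mul,
    Circle.norm_coe, mul_pow, Finset.prod_mul_distrib, Finset.prod_pow_eq_pow_sum]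
  rw [mul_left_comm]
  congr 1
  rw [Finset.mul_sum]
  refine Finset.sum_congr rfl fun β hβ => ?_
  rw [Finset.Nat.mem_antidiagonalTuple.mp hβ]
  ring

lemma modelOrthKernel_scaleNormal_right (m q k : ℕ) (c : Circle) (Z W : Fin (m + q) → ℂ) :
    modelOrthKernel m q k Z (scaleNormal m q c W) =
      (starRingEnd ℂ) (c : ℂ) ^ k * modelOrthKernel m q k Z W := by
  simp only [modelOrthKernel, scaleNormal, Fin.append_left, Fin.append_right, one_mul, norm_mul,
    Circle.norm_coe, mul_pow, Finset.prod_mul_distrib, Finset.prod_pow_eq_pow_sum, map_mul]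
  rw [mul_left_comm]
  congr 1
  rw [Finset.mul_sum]
  refine Finset.sum_congr rfl fun β hβ => ?_
  rw [Finset.Nat.mem_antidiagonalTuple.mp hβ]
  ring

lemma exists_circle_conj_pow_mul_pow_ne_one {k l : ℕ} (hkl : k ≠ l) :
    ∃ c : Circle, (starRingEnd ℂ) (c : ℂ) ^ k * (c : ℂ) ^ l ≠ 1 := by
  refine ⟨Circle.exp 1, fun h => hkl ?_⟩
  rw [← Circle.coe_inv_eq_conj, Circle.coe_inv, inv_pow,
    inv_mul_eq_one₀ (pow_ne_zero _ (Circle.coe_ne_zero _)), Circle.coe_exp, ← Complex.exp_nat_mul,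
    ← Complex.exp_nat_mul, Complex.exp_eq_exp_iff_exists_int] at h
  obtain ⟨n, hn⟩ := h
  have him : (k : ℝ) = l + n * (2 * π) := by
    simpa using congrArg Complex.im hn
  by_contra hne
  have hn0 : n ≠ 0 := by
    rintro rfl
    exact hne (by exact_mod_cast (by simpa using him : (k : ℝ) = l))
  refine irrational_pi ⟨((k : ℚ) - l) / (2 * n), ?_⟩
  have : (n : ℝ) ≠ 0 := by exact_mod_cast hn0
  push_cast
  rw [him]
  field_simp
  ring

theorem statement5 (m q k l : ℕ) (hkl : k ≠ l) (Z Z' : Fin (m + q) → ℂ) :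
    (Integrable (fun W : Fin (m + q) → ℂ =>
        modelOrthKernel m q k Z W * modelOrthKernel m q l W Z') volume) ∧
    (∫ W : Fin (m + q) → ℂ, modelOrthKernel m q k Z W * modelOrthKernel m q l W Z') = 0 := by
  refine ⟨?_, ?_⟩
  · simp only [modelOrthKernel_mul_eq_sum]
    exact integrable_finsetSum _ fun β _ => integrable_finsetSum _ fun γ _ =>
      (Integrable.fintype_prod fun i => integrable_gaussianMonomial _ _ _ _).const_mul _
  · obtain ⟨c, hc⟩ := exists_circle_conj_pow_mul_pow_ne_one hkl
    have hrot := (measurePreserving_scaleNormal m q c).integral_comp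
      (measurableEmbedding_scaleNormal m q c)
      fun W => modelOrthKernel m q k Z W * modelOrthKernel m q l W Z'
    simp only [modelOrthKernel_scaleNormal_left, modelOrthKernel_scaleNormal_right,
      mul_mul_mul_comm _ _ ((c : ℂ) ^ l), integral_const_mul] at hrot
    exact by_contra fun h0 => hc ((mul_eq_right₀ h0).mp hrot)
end

section
/- Action of the model orthogonal Bergman kernel of order k on monomial sections: for all integers 0 ≤ m ≤ n, every k ∈ ℕ, all multi-indices α ∈ ℕ^m and β ∈ ℕ^{n−m}, and every Z ∈ ℂⁿ, the function W ↦ 𝒫^{⊥,k}_{n,m}(Z,W) · W_Y^α · W_N^β · exp(−(π/2)|W|²) is integrable on ℂⁿ, and its integral equals Z_Y^α · Z_N^β · exp(−(π/2)|Z|²) if |β| = k, and equals 0 if |β| ≠ k. -/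
open MeasureTheory
open scoped Real

theorem integrable_exp_mul_norm_mul_pow_mul_gaussian (c : ℝ) (a : ℕ) :
    Integrable (fun w : ℂ => Real.exp (c * ‖w‖) * ‖w‖ ^ a * Real.exp (-π * ‖w‖ ^ 2)) := by
  have hg : Integrable (fun w : ℂ => Real.exp (-‖w‖ ^ 2)) := by
    have h := (GaussianFourier.integrable_cexp_neg_mul_sq_norm_add (V := ℂ) (b := 1)
      (by simp) 0 0).norm
    refine h.congr (Filter.Eventually.of_forall fun w => ?_)
    simp only [Complex.norm_exp]
    norm_cast
    simp
  refine (hg.const_mul (a.factorial * Real.exp ((c + 1) ^ 2 / 4))).mono'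
    (by fun_prop) (Filter.Eventually.of_forall fun w => ?_)
  have ha : ‖w‖ ^ a ≤ a.factorial * Real.exp ‖w‖ := by
    have h := Real.pow_div_factorial_le_exp ‖w‖ (norm_nonneg w) a
    rwa [div_le_iff₀' (by positivity)] at h
  rw [Real.norm_of_nonneg (by positivity)]
  calc Real.exp (c * ‖w‖) * ‖w‖ ^ a * Real.exp (-π * ‖w‖ ^ 2)
      ≤ Real.exp (c * ‖w‖) * (a.factorial * Real.exp ‖w‖) * Real.exp (-π * ‖w‖ ^ 2) := by gcongr
    _ = a.factorial * Real.exp (c * ‖w‖ + ‖w‖ + -π * ‖w‖ ^ 2) := by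
        rw [Real.exp_add, Real.exp_add]; ring
    _ ≤ a.factorial * Real.exp ((c + 1) ^ 2 / 4 + -‖w‖ ^ 2) := by
        refine mul_le_mul_of_nonneg_left (Real.exp_le_exp.2 ?_) (by positivity)
        nlinarith [mul_nonneg (sub_nonneg.2 Real.pi_gt_three.le) (sq_nonneg ‖w‖),
          sq_nonneg (‖w‖ - (c + 1) / 2), sq_nonneg ‖w‖]
    _ = _ := by rw [Real.exp_add]; ring

theorem integrable_conj_pow_mul_pow_mul_gaussian (b a : ℕ) :
    Integrable (fun w : ℂ =>
      (starRingEnd ℂ) w ^ b * w ^ a * (Real.exp (-π * ‖w‖ ^ 2) : ℂ)) := by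
  refine (integrable_exp_mul_norm_mul_pow_mul_gaussian 0 (b + a)).mono'
    (by fun_prop) (Filter.Eventually.of_forall fun w => le_of_eq ?_)
  rw [norm_mul, norm_mul, norm_pow, norm_pow, RCLike.norm_conj, Complex.norm_real,
    Real.norm_of_nonneg (Real.exp_nonneg _)]
  simp [pow_add]

theorem integral_conj_pow_mul_pow_mul_gaussian_of_ne {b a : ℕ} (h : b ≠ a) :
    ∫ w : ℂ, (starRingEnd ℂ) w ^ b * w ^ a * (Real.exp (-π * ‖w‖ ^ 2) : ℂ) = 0 := by
  have hab : (a : ℂ) - b ≠ 0 := sub_ne_zero.2 (by exact_mod_cast h.symm)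
  set u : Circle := Circle.exp (π / ((a : ℝ) - b)) with hu
  have hu' : (starRingEnd ℂ) (u : ℂ) ^ b * (u : ℂ) ^ a = -1 := by
    rw [hu, Circle.coe_exp, ← Complex.exp_conj, ← Complex.exp_nat_mul, ← Complex.exp_nat_mul,
      ← Complex.exp_add, ← Complex.exp_pi_mul_I]
    congr 1
    simp only [map_mul, Complex.conj_ofReal, Complex.conj_I]
    push_cast
    field_simp
    ring
  have key := (rotation u).measurePreserving.integral_comp
    (rotation u).toHomeomorph.measurableEmbedding
    (fun w : ℂ => (starRingEnd ℂ) w ^ b * w ^ a * (Real.exp (-π * ‖w‖ ^ 2) : ℂ))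
  have hneg : ∀ w : ℂ, (starRingEnd ℂ) (rotation u w) ^ b * (rotation u w) ^ a *
      (Real.exp (-π * ‖rotation u w‖ ^ 2) : ℂ) =
      -((starRingEnd ℂ) w ^ b * w ^ a * (Real.exp (-π * ‖w‖ ^ 2) : ℂ)) := by
    intro w
    rw [LinearIsometryEquiv.norm_map, rotation_apply, map_mul, mul_pow, mul_pow]
    linear_combination ((starRingEnd ℂ) w ^ b * w ^ a * (Real.exp (-π * ‖w‖ ^ 2) : ℂ)) * hu'
  simp only [hneg, integral_neg] at key
  exact self_eq_neg.1 key.symm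

theorem integral_conj_pow_mul_pow_mul_gaussian_self (a : ℕ) :
    ∫ w : ℂ, (starRingEnd ℂ) w ^ a * w ^ a * (Real.exp (-π * ‖w‖ ^ 2) : ℂ) =
      (a.factorial : ℂ) / (π : ℂ) ^ a := by
  have h := Complex.integral_rpow_mul_exp_neg_mul_rpow (p := 2) (q := 2 * a) (b := π)
    (by norm_num) (by linarith [a.cast_nonneg (α := ℝ)]) Real.pi_pos
  have he : ∀ w : ℂ, (starRingEnd ℂ) w ^ a * w ^ a * (Real.exp (-π * ‖w‖ ^ 2) : ℂ) =
      ((‖w‖ ^ (2 * a : ℝ) * Real.exp (-π * ‖w‖ ^ (2 : ℝ)) : ℝ) : ℂ) := by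
    intro w
    rw [← mul_pow, Complex.conj_mul', Real.rpow_two,
      show (2 * a : ℝ) = ((2 * a : ℕ) : ℝ) by push_cast; rfl, Real.rpow_natCast, pow_mul]
    push_cast
    rfl
  simp_rw [he]
  rw [integral_complex_ofReal, h, show (2 * (a : ℝ) + 2) / 2 = a + 1 by ring,
    Real.Gamma_nat_eq_factorial,
    show -(2 * (a : ℝ) + 2) / 2 = -((a + 1 : ℕ) : ℝ) by push_cast; ring,
    Real.rpow_neg Real.pi_pos.le, Real.rpow_natCast]
  have := Real.pi_ne_zero
  norm_cast
  field_simp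
  ring

theorem integral_conj_pow_mul_pow_mul_gaussian (b a : ℕ) :
    ∫ w : ℂ, (starRingEnd ℂ) w ^ b * w ^ a * (Real.exp (-π * ‖w‖ ^ 2) : ℂ) =
      if b = a then (a.factorial : ℂ) / (π : ℂ) ^ a else 0 := by
  split_ifs with h
  · rw [h, integral_conj_pow_mul_pow_mul_gaussian_self]
  · exact integral_conj_pow_mul_pow_mul_gaussian_of_ne h

theorem integrable_exp_conj_mul_pow_mul_gaussian (z : ℂ) (a : ℕ) :
    Integrable (fun w : ℂ => Complex.exp (π * z * (starRingEnd ℂ) w) * w ^ a *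
      (Real.exp (-π * ‖w‖ ^ 2) : ℂ)) := by
  refine (integrable_exp_mul_norm_mul_pow_mul_gaussian (π * ‖z‖) a).mono'
    (by fun_prop) (Filter.Eventually.of_forall fun w => ?_)
  rw [norm_mul, norm_mul, norm_pow, Complex.norm_real, Real.norm_of_nonneg (Real.exp_nonneg _)]
  gcongr
  refine (Complex.norm_exp_le_exp_norm _).trans_eq ?_
  rw [norm_mul, norm_mul, RCLike.norm_conj, Complex.norm_real,
    Real.norm_of_nonneg Real.pi_pos.le]

/-- The reproducing property of the Bargmann–Fock kernel on monomials. -/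
theorem integral_exp_conj_mul_pow_mul_gaussian (z : ℂ) (a : ℕ) :
    ∫ w : ℂ, Complex.exp (π * z * (starRingEnd ℂ) w) * w ^ a *
      (Real.exp (-π * ‖w‖ ^ 2) : ℂ) = z ^ a := by
  have hexp : ∀ x : ℝ, HasSum (fun n : ℕ => x ^ n / n.factorial) (Real.exp x) := fun x => by
    rw [Real.exp_eq_exp_ℝ]; exact NormedSpace.expSeries_div_hasSum_exp x
  have hcexp : ∀ x : ℂ, HasSum (fun n : ℕ => x ^ n / n.factorial) (Complex.exp x) := fun x => by
    rw [Complex.exp_eq_exp_ℂ]; exact NormedSpace.expSeries_div_hasSum_exp x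
  have hbound : ∀ w : ℂ, HasSum
      (fun n : ℕ => (π * ‖z‖ * ‖w‖) ^ n / n.factorial * ‖w‖ ^ a * Real.exp (-π * ‖w‖ ^ 2))
      (Real.exp (π * ‖z‖ * ‖w‖) * ‖w‖ ^ a * Real.exp (-π * ‖w‖ ^ 2)) := fun w =>
    ((hexp _).mul_right _).mul_right _
  have hsum := hasSum_integral_of_dominated_convergence (μ := (volume : Measure ℂ))
    (F := fun (n : ℕ) (w : ℂ) => (π * z * (starRingEnd ℂ) w) ^ n / n.factorial * w ^ a *
      (Real.exp (-π * ‖w‖ ^ 2) : ℂ))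
    (fun (n : ℕ) (w : ℂ) =>
      (π * ‖z‖ * ‖w‖) ^ n / n.factorial * ‖w‖ ^ a * Real.exp (-π * ‖w‖ ^ 2))
    (fun n => by fun_prop)
    (fun n => Filter.Eventually.of_forall fun w => le_of_eq (by
      simp only [norm_mul, norm_div, norm_pow, RCLike.norm_conj, Complex.norm_real,
        Real.norm_of_nonneg (Real.exp_nonneg _), Real.norm_of_nonneg Real.pi_pos.le,
        Complex.norm_natCast]))
    (Filter.Eventually.of_forall fun w => (hbound w).summable)
    ((integrable_exp_mul_norm_mul_pow_mul_gaussian (π * ‖z‖) a).congr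
      (Filter.Eventually.of_forall fun w => (hbound w).tsum_eq.symm))
    (Filter.Eventually.of_forall fun w => ((hcexp _).mul_right _).mul_right _)
  have hterm : ∀ n : ℕ, ∫ w : ℂ, (π * z * (starRingEnd ℂ) w) ^ n / n.factorial * w ^ a *
      (Real.exp (-π * ‖w‖ ^ 2) : ℂ) = if n = a then z ^ a else 0 := by
    intro n
    have : ∀ w : ℂ, (π * z * (starRingEnd ℂ) w) ^ n / n.factorial * w ^ a *
        (Real.exp (-π * ‖w‖ ^ 2) : ℂ) = ((π * z) ^ n / n.factorial) *
        ((starRingEnd ℂ) w ^ n * w ^ a * (Real.exp (-π * ‖w‖ ^ 2) : ℂ)) := fun w => by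
      rw [mul_pow (π * z)]; ring
    simp_rw [this]
    rw [integral_const_mul, integral_conj_pow_mul_pow_mul_gaussian]
    split_ifs with h
    · subst h
      have h1 : (n.factorial : ℂ) ≠ 0 := by exact_mod_cast n.factorial_ne_zero
      have h2 : (π : ℂ) ≠ 0 := by exact_mod_cast Real.pi_ne_zero
      rw [mul_pow]
      field_simp
    · simp
  simp_rw [hterm] at hsum
  exact hsum.unique (hasSum_ite_eq a (z ^ a))

/-- The one-variable factors of the summand of order `γ` in the kernel applied to a monomial. -/
noncomputable def kernelFactor {m q : ℕ} (α : Fin m → ℕ) (β γ : Fin q → ℕ)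
    (Z : Fin (m + q) → ℂ) : Fin (m + q) → ℂ → ℂ :=
  Fin.addCases
    (fun i w => Complex.exp (π * Z (Fin.castAdd q i) * (starRingEnd ℂ) w) * w ^ α i *
      (Real.exp (-π * ‖w‖ ^ 2) : ℂ))
    (fun j w => (starRingEnd ℂ) w ^ γ j * w ^ β j * (Real.exp (-π * ‖w‖ ^ 2) : ℂ))

theorem integrable_kernelFactor {m q : ℕ} (α : Fin m → ℕ) (β γ : Fin q → ℕ)
    (Z : Fin (m + q) → ℂ) (i : Fin (m + q)) : Integrable (kernelFactor α β γ Z i) := by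
  refine Fin.addCases (fun i => ?_) (fun j => ?_) i
  · simpa only [kernelFactor, Fin.addCases_left] using
      integrable_exp_conj_mul_pow_mul_gaussian _ _
  · simpa only [kernelFactor, Fin.addCases_right] using
      integrable_conj_pow_mul_pow_mul_gaussian _ _

theorem integral_prod_kernelFactor {m q : ℕ} (α : Fin m → ℕ) (β γ : Fin q → ℕ)
    (Z : Fin (m + q) → ℂ) :
    ∫ W : Fin (m + q) → ℂ, ∏ i, kernelFactor α β γ Z i (W i) =
      if γ = β then (∏ i, Z (Fin.castAdd q i) ^ α i) *
        (((∏ j, (β j).factorial : ℕ) : ℂ) / (π : ℂ) ^ (∑ j, β j)) else 0 := by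
  rw [integral_fintype_prod_volume_eq_prod, Fin.prod_univ_add]
  simp only [kernelFactor, Fin.addCases_left, Fin.addCases_right,
    integral_exp_conj_mul_pow_mul_gaussian, integral_conj_pow_mul_pow_mul_gaussian]
  split_ifs with h
  · subst h
    simp [Finset.prod_div_distrib, Finset.prod_pow_eq_pow_sum]
  · obtain ⟨j, hj⟩ := Function.ne_iff.1 h
    rw [Finset.prod_eq_zero (Finset.mem_univ j) (if_neg hj), mul_zero]

theorem modelOrthKernel_mul_monomial {m q : ℕ} (k : ℕ) (α : Fin m → ℕ) (β : Fin q → ℕ)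
    (Z W : Fin (m + q) → ℂ) :
    modelOrthKernel m q k Z W * (∏ i, W (Fin.castAdd q i) ^ α i)
        * (∏ j, W (Fin.natAdd m j) ^ β j) * (Real.exp (-(π / 2) * ∑ i, ‖W i‖ ^ 2) : ℂ) =
      ∑ γ ∈ Finset.Nat.antidiagonalTuple q k,
        ((Real.exp (-(π / 2) * ∑ i, ‖Z i‖ ^ 2) : ℂ) * (π : ℂ) ^ k *
          ((∏ j, Z (Fin.natAdd m j) ^ γ j) / ((∏ j, (γ j).factorial : ℕ) : ℂ))) *
        ∏ i, kernelFactor α β γ Z i (W i) := by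
  have hprod : ∀ γ : Fin q → ℕ, ∏ i, kernelFactor α β γ Z i (W i) =
      Complex.exp (∑ i, π * Z (Fin.castAdd q i) * (starRingEnd ℂ) (W (Fin.castAdd q i))) *
      (Real.exp (-π * ∑ i, ‖W i‖ ^ 2) : ℂ) * (∏ i, W (Fin.castAdd q i) ^ α i) *
      (∏ j, W (Fin.natAdd m j) ^ β j) *
      ∏ j, (starRingEnd ℂ) (W (Fin.natAdd m j)) ^ γ j := by
    intro γ
    rw [Fin.prod_univ_add, Fin.sum_univ_add, mul_add, Real.exp_add, Finset.mul_sum,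
      Finset.mul_sum, Real.exp_sum, Real.exp_sum, Complex.exp_sum]
    simp only [kernelFactor, Fin.addCases_left, Fin.addCases_right, Finset.prod_mul_distrib]
    push_cast
    ring
  have hexp : Complex.exp (-(π : ℂ) / 2 *
      ((∑ i : Fin m, ((‖Z (Fin.castAdd q i)‖ : ℂ) ^ 2 + (‖W (Fin.castAdd q i)‖ : ℂ) ^ 2
          - 2 * Z (Fin.castAdd q i) * (starRingEnd ℂ) (W (Fin.castAdd q i))))
        + ∑ j : Fin q, ((‖Z (Fin.natAdd m j)‖ : ℂ) ^ 2 + (‖W (Fin.natAdd m j)‖ : ℂ) ^ 2))) *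
      (Real.exp (-(π / 2) * ∑ i, ‖W i‖ ^ 2) : ℂ) =
      (Real.exp (-(π / 2) * ∑ i, ‖Z i‖ ^ 2) : ℂ) *
      (Complex.exp (∑ i, π * Z (Fin.castAdd q i) * (starRingEnd ℂ) (W (Fin.castAdd q i))) *
      (Real.exp (-π * ∑ i, ‖W i‖ ^ 2) : ℂ)) := by
    push_cast
    rw [← Complex.exp_add, ← Complex.exp_add, ← Complex.exp_add]
    congr 1
    simp only [Fin.sum_univ_add, Finset.sum_add_distrib, Finset.sum_sub_distrib, mul_assoc,
      ← Finset.mul_sum]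
    ring
  simp_rw [hprod]
  rw [modelOrthKernel, Finset.mul_sum, Finset.sum_mul, Finset.sum_mul, Finset.sum_mul]
  refine Finset.sum_congr rfl fun γ _ => ?_
  linear_combination ((π : ℂ) ^ k * ((∏ j, Z (Fin.natAdd m j) ^ γ j) *
    (∏ j, (starRingEnd ℂ) (W (Fin.natAdd m j)) ^ γ j) / ((∏ j, (γ j).factorial : ℕ) : ℂ)) *
    (∏ i, W (Fin.castAdd q i) ^ α i) * (∏ j, W (Fin.natAdd m j) ^ β j)) * hexp

theorem statement6 (m q k : ℕ) (α : Fin m → ℕ) (β : Fin q → ℕ) (Z : Fin (m + q) → ℂ) :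
    (Integrable (fun W : Fin (m + q) → ℂ =>
        modelOrthKernel m q k Z W * (∏ i, W (Fin.castAdd q i) ^ α i)
          * (∏ j, W (Fin.natAdd m j) ^ β j)
          * (Real.exp (-(π / 2) * ∑ i, ‖W i‖ ^ 2) : ℂ)) volume) ∧
    (∫ W : Fin (m + q) → ℂ,
        modelOrthKernel m q k Z W * (∏ i, W (Fin.castAdd q i) ^ α i)
          * (∏ j, W (Fin.natAdd m j) ^ β j)
          * (Real.exp (-(π / 2) * ∑ i, ‖W i‖ ^ 2) : ℂ)) =
      if (∑ j, β j) = k then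
        (∏ i, Z (Fin.castAdd q i) ^ α i) * (∏ j, Z (Fin.natAdd m j) ^ β j)
          * (Real.exp (-(π / 2) * ∑ i, ‖Z i‖ ^ 2) : ℂ)
      else 0 := by
  have hint : ∀ γ ∈ Finset.Nat.antidiagonalTuple q k, Integrable (fun W : Fin (m + q) → ℂ =>
      ((Real.exp (-(π / 2) * ∑ i, ‖Z i‖ ^ 2) : ℂ) * (π : ℂ) ^ k *
        ((∏ j, Z (Fin.natAdd m j) ^ γ j) / ((∏ j, (γ j).factorial : ℕ) : ℂ))) *
      ∏ i, kernelFactor α β γ Z i (W i)) := fun γ _ =>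
    (Integrable.fintype_prod (integrable_kernelFactor α β γ Z)).const_mul _
  simp_rw [modelOrthKernel_mul_monomial]
  refine ⟨integrable_finsetSum _ hint, ?_⟩
  rw [integral_finsetSum _ hint]
  simp_rw [integral_const_mul, integral_prod_kernelFactor, mul_ite, mul_zero]
  rw [Finset.sum_ite_eq']
  simp only [Finset.Nat.mem_antidiagonalTuple]
  split_ifs with h
  · have h1 : ((∏ j, (β j).factorial : ℕ) : ℂ) ≠ 0 := by
      exact_mod_cast Finset.prod_ne_zero_iff.2 fun j _ => (β j).factorial_ne_zero
    have h2 : (π : ℂ) ≠ 0 := by exact_mod_cast Real.pi_ne_zero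
    rw [h]
    field_simp
  · rfl
end

section
/- Action of the model logarithmic Bergman kernel of order k on monomial sections: for all integers 0 ≤ m ≤ n and k ∈ ℕ, define 𝒫^{(k)}_{n,m} := 𝒫_n − Σ_{l=0}^{k−1} 𝒫^{⊥,l}_{n,m}. Then for all multi-indices α ∈ ℕ^m, β ∈ ℕ^{n−m} and every Z ∈ ℂⁿ, the function W ↦ 𝒫^{(k)}_{n,m}(Z,W) · W_Y^α · W_N^β · exp(−(π/2)|W|²) is integrable on ℂⁿ, and its integral equals Z_Y^α · Z_N^β · exp(−(π/2)|Z|²) if |β| ≥ k, and equals 0 if |β| < k. -/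
open MeasureTheory
open scoped Real

/-- The model Bergman kernel `𝒫_n` of `ℂⁿ`. -/
noncomputable def modelBergmanKernel (n : ℕ) (Z Z' : Fin n → ℂ) : ℂ :=
  Complex.exp (-(π : ℂ) / 2 *
    ∑ i, ((‖Z i‖ : ℂ) ^ 2 + (‖Z' i‖ : ℂ) ^ 2 - 2 * Z i * (starRingEnd ℂ) (Z' i)))

/-- The model logarithmic Bergman kernel `𝒫^{(k)}_{n,m} = 𝒫_n - Σ_{l<k} 𝒫^{⊥,l}_{n,m}`. -/
noncomputable def modelLogKernel (m q k : ℕ) (Z Z' : Fin (m + q) → ℂ) : ℂ :=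
  modelBergmanKernel (m + q) Z Z' - ∑ l ∈ Finset.range k, modelOrthKernel m q l Z Z'

open scoped ComplexConjugate

/-- Polynomially weighted Gaussians are integrable on `ℂ`. -/
lemma integrable_norm_pow_mul_exp_neg_mul_sq (a : ℕ) {c : ℝ} (hc : 0 < c) :
    Integrable (fun w : ℂ => ‖w‖ ^ a * Real.exp (-c * ‖w‖ ^ 2)) := by
  have h := Complex.integral_rpow_mul_exp_neg_mul_rpow (p := 2) (q := a) (b := c)
    (by norm_num) (by have : (0 : ℝ) ≤ a := a.cast_nonneg
                      linarith) hc
  simp only [Real.rpow_natCast, Real.rpow_two] at h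
  refine not_imp_comm.1 integral_undef ?_
  rw [h]
  have : 0 < Real.Gamma (((a : ℝ) + 2) / 2) := Real.Gamma_pos_of_pos (by positivity)
  positivity

lemma integral_norm_pow_two_mul_gaussian (a : ℕ) :
    ∫ w : ℂ, ‖w‖ ^ (2 * a) * Real.exp (-π * ‖w‖ ^ 2) = a.factorial / π ^ a := by
  have h := Complex.integral_rpow_mul_exp_neg_mul_rpow (p := 2) (q := (2 * a : ℕ)) (b := π)
    (by norm_num) (by have : (0 : ℝ) ≤ (2 * a : ℕ) := Nat.cast_nonneg _
                      linarith) Real.pi_pos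
  simp only [Real.rpow_natCast, Real.rpow_two] at h
  have e₁ : (((2 * a : ℕ) : ℝ) + 2) / 2 = a + 1 := by push_cast; ring
  have e₂ : -(((2 * a : ℕ) : ℝ) + 2) / 2 = -((a + 1 : ℕ) : ℝ) := by push_cast; ring
  rw [h, e₁, e₂, Real.Gamma_nat_eq_factorial, Real.rpow_neg Real.pi_pos.le, Real.rpow_natCast, pow_succ]
  field_simp

lemma integrable_pow_mul_conj_pow_mul_gaussian (a b : ℕ) :
    Integrable (fun w : ℂ => w ^ a * conj w ^ b * (Real.exp (-π * ‖w‖ ^ 2) : ℂ)) := by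
  refine (integrable_norm_pow_mul_exp_neg_mul_sq (a + b) Real.pi_pos).mono'
    (by fun_prop) (.of_forall fun w => le_of_eq ?_)
  simp [pow_add, -Complex.ofReal_exp, abs_of_pos, Real.exp_pos]

/-- Orthogonality of monomials with respect to the Gaussian measure on `ℂ`. -/
lemma integral_pow_mul_conj_pow_mul_gaussian (a b : ℕ) :
    ∫ w : ℂ, w ^ a * conj w ^ b * (Real.exp (-π * ‖w‖ ^ 2) : ℂ) =
      if a = b then (a.factorial : ℂ) / (π : ℂ) ^ a else 0 := by
  split_ifs with hab
  · subst hab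
    have h := congrArg (fun x : ℝ => (x : ℂ)) (integral_norm_pow_two_mul_gaussian a)
    simp only [← integral_complex_ofReal] at h
    push_cast at h ⊢
    rw [← h]
    congr 1 with w
    rw [← mul_pow, Complex.mul_conj', ← pow_mul]
  · set u : Circle := Circle.exp (π / ((a : ℝ) - b)) with hu
    have hd : (a : ℂ) - b ≠ 0 := sub_ne_zero.2 (by exact_mod_cast hab)
    have huv : (u : ℂ) ^ a * conj (u : ℂ) ^ b = -1 := by
      rw [hu, Circle.coe_exp, ← Complex.exp_conj, ← Complex.exp_nat_mul, ← Complex.exp_nat_mul,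
        ← Complex.exp_add, ← Complex.exp_pi_mul_I]
      congr 1
      simp only [map_mul, Complex.conj_ofReal, Complex.conj_I]
      push_cast
      field_simp
      ring
    have h := (rotation u).measurePreserving.integral_comp
      (rotation u).toHomeomorph.measurableEmbedding
      (fun w : ℂ => w ^ a * conj w ^ b * (Real.exp (-π * ‖w‖ ^ 2) : ℂ))
    have e : ∀ w : ℂ, (rotation u w) ^ a * conj (rotation u w) ^ b *
        (Real.exp (-π * ‖rotation u w‖ ^ 2) : ℂ) =
        -(w ^ a * conj w ^ b * (Real.exp (-π * ‖w‖ ^ 2) : ℂ)) := by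
      intro w
      rw [LinearIsometryEquiv.norm_map, rotation_apply, map_mul, mul_pow, mul_pow]
      linear_combination (w ^ a * conj w ^ b * (Real.exp (-π * ‖w‖ ^ 2) : ℂ)) * huv
    simp only [e, integral_neg] at h
    exact self_eq_neg.1 h.symm

lemma integrable_exp_mul_pow_mul_gaussian (r : ℝ) (a : ℕ) :
    Integrable (fun w : ℂ =>
      Real.exp (π * (r * ‖w‖)) * (‖w‖ ^ a * Real.exp (-π * ‖w‖ ^ 2))) := by
  refine ((integrable_norm_pow_mul_exp_neg_mul_sq a (half_pos Real.pi_pos)).const_mul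
    (Real.exp (π / 2 * r ^ 2))).mono' (by fun_prop) (.of_forall fun w => ?_)
  rw [Real.norm_of_nonneg (by positivity), mul_left_comm, mul_left_comm (Real.exp (π / 2 * r ^ 2)),
    ← Real.exp_add, ← Real.exp_add]
  refine mul_le_mul_of_nonneg_left (Real.exp_le_exp.2 ?_) (by positivity)
  nlinarith [mul_nonneg Real.pi_pos.le (sq_nonneg (r - ‖w‖))]

/-- The Bargmann–Fock reproducing property for monomials in one variable. -/
lemma integral_exp_mul_pow_mul_gaussian (z : ℂ) (a : ℕ) :
    Integrable (fun w : ℂ =>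
        Complex.exp (π * (z * conj w)) * (w ^ a * (Real.exp (-π * ‖w‖ ^ 2) : ℂ))) ∧
      ∫ w : ℂ, Complex.exp (π * (z * conj w)) * (w ^ a * (Real.exp (-π * ‖w‖ ^ 2) : ℂ)) =
        z ^ a := by
  have hexp : ∀ w : ℂ, HasSum (fun b : ℕ => (π * (‖z‖ * ‖w‖)) ^ b / (b.factorial : ℝ) *
      (‖w‖ ^ a * Real.exp (-π * ‖w‖ ^ 2)))
      (Real.exp (π * (‖z‖ * ‖w‖)) * (‖w‖ ^ a * Real.exp (-π * ‖w‖ ^ 2))) := fun w => by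
    have := NormedSpace.expSeries_div_hasSum_exp (π * (‖z‖ * ‖w‖))
    rw [← Real.exp_eq_exp_ℝ] at this
    exact this.mul_right _
  have hint := integrable_exp_mul_pow_mul_gaussian ‖z‖ a
  constructor
  · refine hint.mono' (by fun_prop) (.of_forall fun w => ?_)
    rw [norm_mul, norm_mul, norm_pow, Complex.norm_real, Real.norm_of_nonneg (Real.exp_pos _).le,
      Complex.norm_exp]
    gcongr
    calc (π * (z * conj w)).re ≤ ‖(π * (z * conj w) : ℂ)‖ := Complex.re_le_norm _
      _ = π * (‖z‖ * ‖w‖) := by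
        simp [abs_of_pos Real.pi_pos]
  · have key := hasSum_integral_of_dominated_convergence (μ := (volume : Measure ℂ))
      (F := fun (b : ℕ) (w : ℂ) => (π * (z * conj w)) ^ b / (b.factorial : ℂ) *
        (w ^ a * (Real.exp (-π * ‖w‖ ^ 2) : ℂ)))
      (f := fun w => Complex.exp (π * (z * conj w)) * (w ^ a * (Real.exp (-π * ‖w‖ ^ 2) : ℂ)))
      (fun b w => (π * (‖z‖ * ‖w‖)) ^ b / (b.factorial : ℝ) *
        (‖w‖ ^ a * Real.exp (-π * ‖w‖ ^ 2)))
      (fun b => by fun_prop)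
      (fun b => .of_forall fun w => le_of_eq (by
        simp [-Complex.ofReal_exp, abs_of_pos Real.pi_pos, abs_of_pos (Real.exp_pos _)]))
      (.of_forall fun w => (hexp w).summable)
      (by simpa only [(hexp _).tsum_eq] using hint)
      (.of_forall fun w => by
        have := NormedSpace.expSeries_div_hasSum_exp ((π : ℂ) * (z * conj w))
        rw [← Complex.exp_eq_exp_ℂ] at this
        exact this.mul_right _)
    have hterm : ∀ b : ℕ, ∫ w : ℂ, (π * (z * conj w)) ^ b / (b.factorial : ℂ) *
        (w ^ a * (Real.exp (-π * ‖w‖ ^ 2) : ℂ)) = if b = a then z ^ a else 0 := by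
      intro b
      have e : ∀ w : ℂ, (π * (z * conj w)) ^ b / (b.factorial : ℂ) *
          (w ^ a * (Real.exp (-π * ‖w‖ ^ 2) : ℂ)) = ((π * z) ^ b / (b.factorial : ℂ)) *
          (w ^ a * conj w ^ b * (Real.exp (-π * ‖w‖ ^ 2) : ℂ)) := fun w => by ring
      simp only [e]
      rw [integral_const_mul, integral_pow_mul_conj_pow_mul_gaussian]
      by_cases hab : a = b
      · subst hab
        have : (a.factorial : ℂ) ≠ 0 := by exact_mod_cast a.factorial_ne_zero
        have : (π : ℂ) ≠ 0 := by exact_mod_cast Real.pi_ne_zero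
        simp only [if_true, mul_pow]
        field_simp
      · simp [hab, Ne.symm hab]
    simp only [hterm] at key
    exact key.unique (hasSum_ite_eq a (z ^ a))

/-- The one-variable factor of the model Bergman kernel acting on `w ^ a`. -/
lemma integral_tangential_factor (z : ℂ) (a : ℕ) :
    Integrable (fun w : ℂ => Complex.exp (-(π : ℂ) / 2 *
        ((‖z‖ : ℂ) ^ 2 + (‖w‖ : ℂ) ^ 2 - 2 * z * conj w)) * w ^ a *
        (Real.exp (-(π / 2) * ‖w‖ ^ 2) : ℂ)) ∧
      ∫ w : ℂ, Complex.exp (-(π : ℂ) / 2 *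
        ((‖z‖ : ℂ) ^ 2 + (‖w‖ : ℂ) ^ 2 - 2 * z * conj w)) * w ^ a *
        (Real.exp (-(π / 2) * ‖w‖ ^ 2) : ℂ) =
        z ^ a * (Real.exp (-(π / 2) * ‖z‖ ^ 2) : ℂ) := by
  have e : ∀ w : ℂ, Complex.exp (-(π : ℂ) / 2 *
        ((‖z‖ : ℂ) ^ 2 + (‖w‖ : ℂ) ^ 2 - 2 * z * conj w)) * w ^ a *
        (Real.exp (-(π / 2) * ‖w‖ ^ 2) : ℂ) = (Real.exp (-(π / 2) * ‖z‖ ^ 2) : ℂ) *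
        (Complex.exp (π * (z * conj w)) * (w ^ a * (Real.exp (-π * ‖w‖ ^ 2) : ℂ))) := by
    intro w
    push_cast
    have h : Complex.exp (-(π : ℂ) / 2 * ((‖z‖ : ℂ) ^ 2 + (‖w‖ : ℂ) ^ 2 - 2 * z * conj w)) *
        Complex.exp (-(π / 2) * (‖w‖ : ℂ) ^ 2) = Complex.exp (-(π / 2) * (‖z‖ : ℂ) ^ 2) *
        (Complex.exp (π * (z * conj w)) * Complex.exp (-π * (‖w‖ : ℂ) ^ 2)) := by
      simp only [← Complex.exp_add]
      congr 1
      ring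
    linear_combination w ^ a * h
  simp only [e]
  obtain ⟨h₁, h₂⟩ := integral_exp_mul_pow_mul_gaussian z a
  exact ⟨h₁.const_mul _, by rw [integral_const_mul, h₂, mul_comm]⟩

/-- The one-variable factor of the model orthogonal Bergman kernel acting on `w ^ a`. -/
lemma integral_normal_factor (z : ℂ) (a b : ℕ) :
    Integrable (fun w : ℂ => Complex.exp (-(π : ℂ) / 2 * ((‖z‖ : ℂ) ^ 2 + (‖w‖ : ℂ) ^ 2)) *
        ((π : ℂ) ^ b * (z ^ b * conj w ^ b / (b.factorial : ℂ))) * w ^ a *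
        (Real.exp (-(π / 2) * ‖w‖ ^ 2) : ℂ)) ∧
      ∫ w : ℂ, Complex.exp (-(π : ℂ) / 2 * ((‖z‖ : ℂ) ^ 2 + (‖w‖ : ℂ) ^ 2)) *
        ((π : ℂ) ^ b * (z ^ b * conj w ^ b / (b.factorial : ℂ))) * w ^ a *
        (Real.exp (-(π / 2) * ‖w‖ ^ 2) : ℂ) =
        if a = b then z ^ a * (Real.exp (-(π / 2) * ‖z‖ ^ 2) : ℂ) else 0 := by
  have e : ∀ w : ℂ, Complex.exp (-(π : ℂ) / 2 * ((‖z‖ : ℂ) ^ 2 + (‖w‖ : ℂ) ^ 2)) *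
        ((π : ℂ) ^ b * (z ^ b * conj w ^ b / (b.factorial : ℂ))) * w ^ a *
        (Real.exp (-(π / 2) * ‖w‖ ^ 2) : ℂ) =
        ((Real.exp (-(π / 2) * ‖z‖ ^ 2) : ℂ) * ((π : ℂ) ^ b * z ^ b / (b.factorial : ℂ))) *
        (w ^ a * conj w ^ b * (Real.exp (-π * ‖w‖ ^ 2) : ℂ)) := by
    intro w
    push_cast
    have h : Complex.exp (-(π : ℂ) / 2 * ((‖z‖ : ℂ) ^ 2 + (‖w‖ : ℂ) ^ 2)) *
        Complex.exp (-(π / 2) * (‖w‖ : ℂ) ^ 2) = Complex.exp (-(π / 2) * (‖z‖ : ℂ) ^ 2) *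
        Complex.exp (-π * (‖w‖ : ℂ) ^ 2) := by
      simp only [← Complex.exp_add]
      congr 1
      ring
    linear_combination ((π : ℂ) ^ b * (z ^ b * conj w ^ b / (b.factorial : ℂ))) * w ^ a * h
  simp only [e]
  refine ⟨(integrable_pow_mul_conj_pow_mul_gaussian a b).const_mul _, ?_⟩
  rw [integral_const_mul, integral_pow_mul_conj_pow_mul_gaussian]
  split_ifs with hab
  · subst hab
    have : (a.factorial : ℂ) ≠ 0 := by exact_mod_cast a.factorial_ne_zero
    have : (π : ℂ) ≠ 0 := by exact_mod_cast Real.pi_ne_zero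
    field_simp
  · simp

/-- Fubini for a product of one-variable functions, the variables being split in two blocks. -/
lemma integral_prod_castAdd_mul_prod_natAdd {m q : ℕ} {F : Fin m → ℂ → ℂ} {G : Fin q → ℂ → ℂ}
    (hF : ∀ i, Integrable (F i)) (hG : ∀ j, Integrable (G j)) :
    Integrable (fun W : Fin (m + q) → ℂ =>
        (∏ i, F i (W (Fin.castAdd q i))) * ∏ j, G j (W (Fin.natAdd m j))) ∧
      ∫ W : Fin (m + q) → ℂ,
        (∏ i, F i (W (Fin.castAdd q i))) * ∏ j, G j (W (Fin.natAdd m j)) =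
        (∏ i, ∫ w, F i w) * ∏ j, ∫ w, G j w := by
  have e : ∀ W : Fin (m + q) → ℂ,
      (∏ i, F i (W (Fin.castAdd q i))) * ∏ j, G j (W (Fin.natAdd m j)) =
        ∏ i, (Fin.append F G) i (W i) := fun W => by simp [Fin.prod_univ_add]
  simp only [e]
  constructor
  · refine Integrable.fintype_prod fun i => ?_
    induction i using Fin.addCases <;> simp [hF, hG]
  · rw [integral_fintype_prod_volume_eq_prod, Fin.prod_univ_add]
    simp

lemma exp_neg_mul_sum_sq_eq_prod {m q : ℕ} (W : Fin (m + q) → ℂ) :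
    (Real.exp (-(π / 2) * ∑ i, ‖W i‖ ^ 2) : ℂ) =
      (∏ i, (Real.exp (-(π / 2) * ‖W (Fin.castAdd q i)‖ ^ 2) : ℂ)) *
        ∏ j, (Real.exp (-(π / 2) * ‖W (Fin.natAdd m j)‖ ^ 2) : ℂ) := by
  rw [Finset.mul_sum, Real.exp_sum, Fin.prod_univ_add]
  push_cast
  rfl

/-- The model Bergman kernel reproduces monomial sections. -/
lemma integral_modelBergmanKernel_mul {m q : ℕ} (α : Fin m → ℕ) (β : Fin q → ℕ)
    (Z : Fin (m + q) → ℂ) :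
    Integrable (fun W : Fin (m + q) → ℂ =>
        modelBergmanKernel (m + q) Z W * (∏ i, W (Fin.castAdd q i) ^ α i)
          * (∏ j, W (Fin.natAdd m j) ^ β j)
          * (Real.exp (-(π / 2) * ∑ i, ‖W i‖ ^ 2) : ℂ)) ∧
      ∫ W : Fin (m + q) → ℂ,
        modelBergmanKernel (m + q) Z W * (∏ i, W (Fin.castAdd q i) ^ α i)
          * (∏ j, W (Fin.natAdd m j) ^ β j)
          * (Real.exp (-(π / 2) * ∑ i, ‖W i‖ ^ 2) : ℂ) =
        (∏ i, Z (Fin.castAdd q i) ^ α i) * (∏ j, Z (Fin.natAdd m j) ^ β j)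
          * (Real.exp (-(π / 2) * ∑ i, ‖Z i‖ ^ 2) : ℂ) := by
  have h := integral_prod_castAdd_mul_prod_natAdd
    (fun i => (integral_tangential_factor (Z (Fin.castAdd q i)) (α i)).1)
    (fun j => (integral_tangential_factor (Z (Fin.natAdd m j)) (β j)).1)
  simp only [(integral_tangential_factor _ _).2, Finset.prod_mul_distrib] at h
  have e : ∀ W : Fin (m + q) → ℂ,
      modelBergmanKernel (m + q) Z W = (∏ i, Complex.exp (-(π : ℂ) / 2 *
        ((‖Z (Fin.castAdd q i)‖ : ℂ) ^ 2 + (‖W (Fin.castAdd q i)‖ : ℂ) ^ 2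
          - 2 * Z (Fin.castAdd q i) * conj (W (Fin.castAdd q i))))) *
        ∏ j, Complex.exp (-(π : ℂ) / 2 *
        ((‖Z (Fin.natAdd m j)‖ : ℂ) ^ 2 + (‖W (Fin.natAdd m j)‖ : ℂ) ^ 2
          - 2 * Z (Fin.natAdd m j) * conj (W (Fin.natAdd m j)))) := fun W => by
    rw [modelBergmanKernel, Finset.mul_sum, Complex.exp_sum, Fin.prod_univ_add]
  simp only [e, exp_neg_mul_sum_sq_eq_prod]
  refine ⟨h.1.congr (.of_forall fun W => by dsimp only; ring), ?_⟩
  rw [mul_mul_mul_comm, ← h.2]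
  congr 1 with W
  ring

/-- The model orthogonal Bergman kernel of order `l` projects onto the monomial sections of
normal degree `l`. -/
lemma integral_modelOrthKernel_mul {m q : ℕ} (l : ℕ) (α : Fin m → ℕ) (β : Fin q → ℕ)
    (Z : Fin (m + q) → ℂ) :
    Integrable (fun W : Fin (m + q) → ℂ =>
        modelOrthKernel m q l Z W * (∏ i, W (Fin.castAdd q i) ^ α i)
          * (∏ j, W (Fin.natAdd m j) ^ β j)
          * (Real.exp (-(π / 2) * ∑ i, ‖W i‖ ^ 2) : ℂ)) ∧
      ∫ W : Fin (m + q) → ℂ,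
        modelOrthKernel m q l Z W * (∏ i, W (Fin.castAdd q i) ^ α i)
          * (∏ j, W (Fin.natAdd m j) ^ β j)
          * (Real.exp (-(π / 2) * ∑ i, ‖W i‖ ^ 2) : ℂ) =
        if ∑ j, β j = l then
          (∏ i, Z (Fin.castAdd q i) ^ α i) * (∏ j, Z (Fin.natAdd m j) ^ β j)
            * (Real.exp (-(π / 2) * ∑ i, ‖Z i‖ ^ 2) : ℂ)
        else 0 := by
  have h := fun δ : Fin q → ℕ => integral_prod_castAdd_mul_prod_natAdd
    (fun i => (integral_tangential_factor (Z (Fin.castAdd q i)) (α i)).1)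
    (fun j => (integral_normal_factor (Z (Fin.natAdd m j)) (β j) (δ j)).1)
  simp only [(integral_tangential_factor _ _).2, (integral_normal_factor _ _ _).2,
    Fintype.prod_ite_zero, ← funext_iff] at h
  have e : ∀ W : Fin (m + q) → ℂ,
      modelOrthKernel m q l Z W * (∏ i, W (Fin.castAdd q i) ^ α i)
          * (∏ j, W (Fin.natAdd m j) ^ β j)
          * (Real.exp (-(π / 2) * ∑ i, ‖W i‖ ^ 2) : ℂ) =
      ∑ δ ∈ Finset.Nat.antidiagonalTuple q l,
        (∏ i, Complex.exp (-(π : ℂ) / 2 *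
          ((‖Z (Fin.castAdd q i)‖ : ℂ) ^ 2 + (‖W (Fin.castAdd q i)‖ : ℂ) ^ 2
            - 2 * Z (Fin.castAdd q i) * conj (W (Fin.castAdd q i)))) *
          W (Fin.castAdd q i) ^ α i *
          (Real.exp (-(π / 2) * ‖W (Fin.castAdd q i)‖ ^ 2) : ℂ)) *
        ∏ j, Complex.exp (-(π : ℂ) / 2 *
          ((‖Z (Fin.natAdd m j)‖ : ℂ) ^ 2 + (‖W (Fin.natAdd m j)‖ : ℂ) ^ 2)) *
          ((π : ℂ) ^ δ j * (Z (Fin.natAdd m j) ^ δ j * conj (W (Fin.natAdd m j)) ^ δ j /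
            ((δ j).factorial : ℂ))) * W (Fin.natAdd m j) ^ β j *
          (Real.exp (-(π / 2) * ‖W (Fin.natAdd m j)‖ ^ 2) : ℂ) := by
    intro W
    rw [modelOrthKernel, exp_neg_mul_sum_sq_eq_prod, mul_add, Complex.exp_add,
      Finset.mul_sum Finset.univ, Finset.mul_sum Finset.univ, Complex.exp_sum, Complex.exp_sum]
    simp only [Finset.mul_sum, Finset.sum_mul]
    refine Finset.sum_congr rfl fun δ hδ => ?_
    rw [Finset.Nat.mem_antidiagonalTuple] at hδ
    simp only [Finset.prod_mul_distrib, Finset.prod_div_distrib, Finset.prod_pow_eq_pow_sum, hδ,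
      Nat.cast_prod]
    ring
  simp only [e]
  refine ⟨integrable_finsetSum _ fun δ _ => (h δ).1, ?_⟩
  rw [integral_finsetSum _ fun δ _ => (h δ).1]
  simp only [(h _).2, mul_ite, mul_zero, Finset.sum_ite_eq, Finset.Nat.mem_antidiagonalTuple]
  refine if_congr Iff.rfl ?_ rfl
  rw [exp_neg_mul_sum_sq_eq_prod, mul_mul_mul_comm, Finset.prod_mul_distrib,
    Finset.prod_mul_distrib]

theorem statement7 (m q k : ℕ) (α : Fin m → ℕ) (β : Fin q → ℕ) (Z : Fin (m + q) → ℂ) :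
    (Integrable (fun W : Fin (m + q) → ℂ =>
        modelLogKernel m q k Z W * (∏ i, W (Fin.castAdd q i) ^ α i)
          * (∏ j, W (Fin.natAdd m j) ^ β j)
          * (Real.exp (-(π / 2) * ∑ i, ‖W i‖ ^ 2) : ℂ)) volume) ∧
    (∫ W : Fin (m + q) → ℂ,
        modelLogKernel m q k Z W * (∏ i, W (Fin.castAdd q i) ^ α i)
          * (∏ j, W (Fin.natAdd m j) ^ β j)
          * (Real.exp (-(π / 2) * ∑ i, ‖W i‖ ^ 2) : ℂ)) =
      if k ≤ (∑ j, β j) then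
        (∏ i, Z (Fin.castAdd q i) ^ α i) * (∏ j, Z (Fin.natAdd m j) ^ β j)
          * (Real.exp (-(π / 2) * ∑ i, ‖Z i‖ ^ 2) : ℂ)
      else 0 := by
  have hP := integral_modelBergmanKernel_mul α β Z
  have hO := fun l => integral_modelOrthKernel_mul l α β Z
  have hS := integrable_finsetSum (Finset.range k) fun l _ => (hO l).1
  simp only [modelLogKernel, sub_mul, Finset.sum_mul]
  refine ⟨hP.1.sub hS, ?_⟩
  rw [integral_sub hP.1 hS, hP.2, integral_finsetSum _ fun l _ => (hO l).1]
  simp only [(hO _).2, Finset.sum_ite_eq, Finset.mem_range]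
  by_cases hk : k ≤ ∑ j, β j
  · simp [hk, not_lt.2 hk]
  · simp [hk, not_le.1 hk]
end

section
/- Kernel calculus, projection–projection composition (Lemma 3.1, part 1): for all integers 0 ≤ m ≤ n and any polynomials A₁(Z,Z'), A₂(Z,Z') on ℂⁿ × ℂⁿ, there exists a polynomial A₃(Z,Z') on ℂⁿ × ℂⁿ with deg A₃ ≤ deg A₁ + deg A₂ such that for all Z, Z' ∈ ℂⁿ the function W ↦ A₁(Z,W)·𝒫^{⊥,0}_{n,m}(Z,W)·A₂(W,Z')·𝒫^{⊥,0}_{n,m}(W,Z') is integrable on ℂⁿ and ∫_{ℂⁿ} A₁(Z,W)·𝒫^{⊥,0}_{n,m}(Z,W)·A₂(W,Z')·𝒫^{⊥,0}_{n,m}(W,Z') dV(W) = A₃(Z,Z')·𝒫^{⊥,0}_{n,m}(Z,Z'). Moreover, if A₁ and A₂ are both even or both odd then A₃ can be chosen even, and if one of them is even and the other odd then A₃ can be chosen odd. -/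
open MeasureTheory
open scoped Real

/-- The model orthogonal Bergman kernel of order `0`, `𝒫^{⊥,0}_{n,m}`, on `ℂⁿ` with
`n = m + q`; the first `m` coordinates are tangential, the last `q` normal. -/
noncomputable def modelOrthKernel0 (m q : ℕ) (Z Z' : Fin (m + q) → ℂ) : ℂ :=
  Complex.exp (-(π : ℂ) / 2 *
      ((∑ i : Fin m, ((‖Z (Fin.castAdd q i)‖ : ℂ) ^ 2 + (‖Z' (Fin.castAdd q i)‖ : ℂ) ^ 2
          - 2 * Z (Fin.castAdd q i) * (starRingEnd ℂ) (Z' (Fin.castAdd q i))))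
        + ∑ j : Fin q, ((‖Z (Fin.natAdd m j)‖ : ℂ) ^ 2 + (‖Z' (Fin.natAdd m j)‖ : ℂ) ^ 2)))

/-- The real coordinates of a point of `ℂⁿ`, viewed as complex numbers; the `2n`
coordinates are indexed by `Fin n ⊕ Fin n` (real parts, then imaginary parts). -/
noncomputable def realCoords {n : ℕ} (Z : Fin n → ℂ) : Fin n ⊕ Fin n → ℂ :=
  Sum.elim (fun i => ((Z i).re : ℂ)) (fun i => ((Z i).im : ℂ))

/-- Evaluation, at a pair of points `(Z, Z') ∈ ℂⁿ × ℂᵐ`, of a polynomial with complex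
coefficients in the `2n + 2m` real coordinates of `(Z, Z')`. -/
noncomputable def polyEval₂ {n m : ℕ}
    (A : MvPolynomial ((Fin n ⊕ Fin n) ⊕ (Fin m ⊕ Fin m)) ℂ)
    (Z : Fin n → ℂ) (Z' : Fin m → ℂ) : ℂ :=
  MvPolynomial.eval (Sum.elim (realCoords Z) (realCoords Z')) A

/-- A polynomial on `ℂⁿ × ℂᵐ` is even if it is invariant under simultaneous negation
of both arguments. -/
def IsEvenPoly {n m : ℕ}
    (A : MvPolynomial ((Fin n ⊕ Fin n) ⊕ (Fin m ⊕ Fin m)) ℂ) : Prop :=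
  ∀ (Z : Fin n → ℂ) (Z' : Fin m → ℂ), polyEval₂ A (-Z) (-Z') = polyEval₂ A Z Z'

/-- A polynomial on `ℂⁿ × ℂᵐ` is odd if it changes sign under simultaneous negation
of both arguments. -/
def IsOddPoly {n m : ℕ}
    (A : MvPolynomial ((Fin n ⊕ Fin n) ⊕ (Fin m ⊕ Fin m)) ℂ) : Prop :=
  ∀ (Z : Fin n → ℂ) (Z' : Fin m → ℂ), polyEval₂ A (-Z) (-Z') = -polyEval₂ A Z Z'

/-- The `k`-th moment of the Gaussian of density `exp (-π (t - x) ^ 2)`, as a polynomial expression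
in its centre `x`. -/
noncomputable def gaussianMoment {R : Type*} [CommRing R] [Algebra ℂ R] (x : R) : ℕ → R
  | 0 => 1
  | 1 => x
  | k + 2 => x * gaussianMoment x (k + 1) +
      algebraMap ℂ R ((k + 1 : ℂ) / (2 * π)) * gaussianMoment x k

lemma map_gaussianMoment {R S : Type*} [CommRing R] [Algebra ℂ R] [CommRing S] [Algebra ℂ S]
    (f : R →ₐ[ℂ] S) (x : R) (k : ℕ) : f (gaussianMoment x k) = gaussianMoment (f x) k := by
  induction k using Nat.twoStepInduction with
  | zero => simp [gaussianMoment]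
  | one => simp [gaussianMoment]
  | more k h₀ h₁ => simp [gaussianMoment, h₀, h₁]

lemma totalDegree_gaussianMoment_le {σ : Type*} {p : MvPolynomial σ ℂ} (hp : p.totalDegree ≤ 1)
    (k : ℕ) : (gaussianMoment p k).totalDegree ≤ k := by
  induction k using Nat.twoStepInduction with
  | zero => simp [gaussianMoment]
  | one => simpa [gaussianMoment] using hp
  | more k h₀ h₁ =>
    rw [gaussianMoment]
    refine (MvPolynomial.totalDegree_add _ _).trans (max_le ?_ ?_)
    · exact (MvPolynomial.totalDegree_mul _ _).trans (by lia)
    · refine (MvPolynomial.totalDegree_mul _ _).trans ?_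
      rw [MvPolynomial.algebraMap_eq, MvPolynomial.totalDegree_C]
      lia

lemma integrable_pow_mul_gaussian (c : ℂ) (k : ℕ) :
    Integrable fun t : ℝ => (t : ℂ) ^ k * Complex.exp (-π * (t - c) ^ 2) := by
  have hb : (-(π : ℂ)).re < 0 := by simp [Real.pi_pos]
  have h (s : ℂ) := integrable_cexp_quadratic' hb (2 * π * c + s) (-π * c ^ 2)
  have hs (s : ℝ) (t : ℝ) : ‖Complex.exp (-π * t ^ 2 + (2 * π * c + s) * t + -π * c ^ 2)‖
      = Real.exp (s * t) * ‖Complex.exp (-π * (t - c) ^ 2)‖ := by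
    have : -π * t ^ 2 + (2 * π * c + s) * t + -π * c ^ 2
        = ((s * t : ℝ) : ℂ) + -π * (t - c) ^ 2 := by push_cast; ring
    rw [this, Complex.exp_add, norm_mul, ← Complex.ofReal_exp, Complex.norm_real,
      Real.norm_of_nonneg (Real.exp_pos _).le]
  refine Integrable.mono' (((h (1 : ℝ)).norm.add (h (-1 : ℝ)).norm).const_mul (k.factorial : ℝ))
    (by fun_prop) (Filter.Eventually.of_forall fun t => ?_)
  rw [Pi.add_apply, hs, hs, ← add_mul, ← mul_assoc, norm_mul, norm_pow, Complex.norm_real,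
    Real.norm_eq_abs]
  gcongr
  have h₁ := Real.pow_div_factorial_le_exp |t| (abs_nonneg t) k
  rw [div_le_iff₀ (by positivity), mul_comm] at h₁
  refine h₁.trans ?_
  gcongr
  have := Real.exp_pos t
  have := Real.exp_pos (-t)
  rcases abs_cases t with ⟨h, _⟩ | ⟨h, _⟩ <;> simp only [h, one_mul, neg_mul] <;> linarith

lemma integral_pow_mul_gaussian (c : ℂ) (k : ℕ) :
    ∫ t : ℝ, (t : ℂ) ^ k * Complex.exp (-π * (t - c) ^ 2) = gaussianMoment c k := by
  have hπ : (π : ℂ) ≠ 0 := by exact_mod_cast Real.pi_ne_zero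
  have hexp (t : ℝ) : HasDerivAt (fun t : ℝ => Complex.exp (-π * (t - c) ^ 2))
      (Complex.exp (-π * (t - c) ^ 2) * (-π * (2 * (t - c)))) t := by
    have h := (((hasDerivAt_id t).ofReal_comp.sub_const c).pow 2).const_mul (-(π : ℂ))
    simpa using h.cexp
  have hint := integrable_pow_mul_gaussian c
  have h₀ : ∫ t : ℝ, Complex.exp (-π * (t - c) ^ 2) = 1 := by
    have hb : (-(π : ℂ)).re < 0 := by simp [Real.pi_pos]
    have h := integral_cexp_quadratic hb (2 * π * c) (-π * c ^ 2)
    have hc : -π * c ^ 2 - (2 * π * c) ^ 2 / (4 * -π) = 0 := by field_simp; ring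
    rw [neg_neg, div_self hπ, Complex.one_cpow, hc, Complex.exp_zero, one_mul] at h
    rw [← h]
    congr with t
    ring_nf
  induction k using Nat.twoStepInduction with
  | zero => simpa [gaussianMoment] using h₀
  | one =>
    have hf (t : ℝ) : HasDerivAt (fun t : ℝ => Complex.exp (-π * (t - c) ^ 2))
        (-(2 * π) * ((t : ℂ) ^ 1 * Complex.exp (-π * (t - c) ^ 2)
          - c * ((t : ℂ) ^ 0 * Complex.exp (-π * (t - c) ^ 2)))) t := by
      convert! hexp t using 1
      ring
    have h := integral_eq_zero_of_hasDerivAt_of_integrable hf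
      (((hint 1).sub ((hint 0).const_mul c)).const_mul _) (by simpa using hint 0)
    rw [integral_const_mul, integral_sub (hint 1) ((hint 0).const_mul c),
      integral_const_mul] at h
    simp only [pow_zero, one_mul, h₀, mul_one] at h
    rw [gaussianMoment]
    have : -(2 * π : ℂ) ≠ 0 := by simp
    exact sub_eq_zero.1 ((mul_eq_zero.1 h).resolve_left this)
  | more k ih₀ ih₁ =>
    have hf (t : ℝ) : HasDerivAt (fun t : ℝ => (t : ℂ) ^ (k + 1) * Complex.exp (-π * (t - c) ^ 2))
        ((k + 1) * ((t : ℂ) ^ k * Complex.exp (-π * (t - c) ^ 2))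
          - 2 * π * ((t : ℂ) ^ (k + 2) * Complex.exp (-π * (t - c) ^ 2)
          - c * ((t : ℂ) ^ (k + 1) * Complex.exp (-π * (t - c) ^ 2)))) t := by
      convert! ((hasDerivAt_id t).ofReal_comp.pow (k + 1)).mul (hexp t) using 1
      simp
      ring
    have hsub : Integrable fun t : ℝ => (t : ℂ) ^ (k + 2) * Complex.exp (-π * (t - c) ^ 2)
        - c * ((t : ℂ) ^ (k + 1) * Complex.exp (-π * (t - c) ^ 2)) :=
      (hint (k + 2)).sub ((hint (k + 1)).const_mul c)
    have h := integral_eq_zero_of_hasDerivAt_of_integrable hf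
      (((hint k).const_mul _).sub (hsub.const_mul _)) (hint (k + 1))
    rw [integral_sub ((hint k).const_mul _) (hsub.const_mul _), integral_const_mul,
      integral_const_mul, integral_sub (hint (k + 2)) ((hint (k + 1)).const_mul c),
      integral_const_mul, ih₀, ih₁] at h
    rw [gaussianMoment, Algebra.algebraMap_self, RingHom.id_apply]
    apply mul_left_cancel₀ (mul_ne_zero two_ne_zero hπ)
    rw [mul_add, ← mul_assoc, ← mul_assoc, mul_div_cancel₀ _ (mul_ne_zero two_ne_zero hπ)]
    linear_combination -h

lemma integrable_re_mul_im {f g : ℝ → ℂ} (hf : Integrable f) (hg : Integrable g) :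
    Integrable fun w : ℂ => f w.re * g w.im :=
  (Complex.volume_preserving_equiv_real_prod.integrable_comp_emb
    Complex.measurableEquivRealProd.measurableEmbedding).2 (hf.mul_prod hg)

lemma integral_re_mul_im (f g : ℝ → ℂ) :
    ∫ w : ℂ, f w.re * g w.im = (∫ x, f x) * ∫ y, g y := by
  rw [← integral_prod_mul]
  exact Complex.volume_preserving_equiv_real_prod.integral_comp
    Complex.measurableEquivRealProd.measurableEmbedding fun p : ℝ × ℝ => f p.1 * g p.2

section MonomialGaussian

variable {n : ℕ} (c : Fin n ⊕ Fin n → ℂ) (β : Fin n ⊕ Fin n → ℕ)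

lemma prod_realCoords_eq (W : Fin n → ℂ) :
    ∏ j, (realCoords W j ^ β j * Complex.exp (-π * (realCoords W j - c j) ^ 2))
      = ∏ i, (((W i).re : ℂ) ^ β (.inl i) * Complex.exp (-π * ((W i).re - c (.inl i)) ^ 2)
        * (((W i).im : ℂ) ^ β (.inr i) * Complex.exp (-π * ((W i).im - c (.inr i)) ^ 2))) := by
  rw [Fintype.prod_sum_type, ← Finset.prod_mul_distrib]
  rfl

lemma integrable_monomial_mul_gaussian :
    Integrable fun W : Fin n → ℂ =>
      ∏ j, (realCoords W j ^ β j * Complex.exp (-π * (realCoords W j - c j) ^ 2)) := by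
  simp_rw [prod_realCoords_eq]
  exact Integrable.fintype_prod (μ := fun _ => volume) fun i => integrable_re_mul_im
    (integrable_pow_mul_gaussian (c (.inl i)) (β (.inl i)))
    (integrable_pow_mul_gaussian (c (.inr i)) (β (.inr i)))

lemma integral_monomial_mul_gaussian :
    ∫ W : Fin n → ℂ, ∏ j, (realCoords W j ^ β j * Complex.exp (-π * (realCoords W j - c j) ^ 2))
      = ∏ j, gaussianMoment (c j) (β j) := by
  simp_rw [prod_realCoords_eq]
  rw [integral_fintype_prod_volume_eq_prod fun i (w : ℂ) =>
    (w.re : ℂ) ^ β (.inl i) * Complex.exp (-π * (w.re - c (.inl i)) ^ 2)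
      * ((w.im : ℂ) ^ β (.inr i) * Complex.exp (-π * (w.im - c (.inr i)) ^ 2))]
  rw [Fintype.prod_sum_type, ← Finset.prod_mul_distrib]
  refine Finset.prod_congr rfl fun i _ => ?_
  rw [← integral_pow_mul_gaussian, ← integral_pow_mul_gaussian]
  exact integral_re_mul_im
    (fun t : ℝ => (t : ℂ) ^ β (.inl i) * Complex.exp (-π * (t - c (.inl i)) ^ 2))
    (fun t : ℝ => (t : ℂ) ^ β (.inr i) * Complex.exp (-π * (t - c (.inr i)) ^ 2))

end MonomialGaussian

section Centre

variable (m q : ℕ)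

open MvPolynomial in
/-- The complex centre of the Gaussian `W ↦ 𝒫^{⊥,0}(Z, W) 𝒫^{⊥,0}(W, Z')` in each real coordinate
of `W`, as a polynomial in `(Z, Z')`. -/
noncomputable def gaussianCentre : Fin (m + q) ⊕ Fin (m + q) →
    MvPolynomial ((Fin (m + q) ⊕ Fin (m + q)) ⊕ (Fin (m + q) ⊕ Fin (m + q))) ℂ :=
  Sum.elim
    (Fin.addCases (fun i => let j := Fin.castAdd q i
      C (1 / 2) * X (.inl (.inl j)) + C (Complex.I / 2) * X (.inl (.inr j))
        + C (1 / 2) * X (.inr (.inl j)) + C (-Complex.I / 2) * X (.inr (.inr j))) fun _ => 0)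
    (Fin.addCases (fun i => let j := Fin.castAdd q i
      C (-Complex.I / 2) * X (.inl (.inl j)) + C (1 / 2) * X (.inl (.inr j))
        + C (Complex.I / 2) * X (.inr (.inl j)) + C (1 / 2) * X (.inr (.inr j))) fun _ => 0)

open MvPolynomial in
lemma totalDegree_gaussianCentre_le (j : Fin (m + q) ⊕ Fin (m + q)) :
    (gaussianCentre m q j).totalDegree ≤ 1 := by
  have hCX {σ : Type} (a : ℂ) (s : σ) : (C a * X s : MvPolynomial σ ℂ).totalDegree ≤ 1 :=
    (totalDegree_mul _ _).trans (by simp)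
  have hadd {σ : Type} {p r : MvPolynomial σ ℂ} (hp : p.totalDegree ≤ 1)
      (hr : r.totalDegree ≤ 1) : (p + r).totalDegree ≤ 1 :=
    (totalDegree_add _ _).trans (max_le hp hr)
  rcases j with j | j <;> induction j using Fin.addCases <;>
    simp only [gaussianCentre, Sum.elim_inl, Sum.elim_inr, Fin.addCases_left, Fin.addCases_right,
      totalDegree_zero, zero_le]
  all_goals exact hadd (hadd (hadd (hCX _ _) (hCX _ _)) (hCX _ _)) (hCX _ _)

variable {m q}

lemma conj_eq_re_sub_im (w : ℂ) : (starRingEnd ℂ) w = w.re - w.im * Complex.I := by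
  apply Complex.ext <;> simp

lemma polyEval₂_gaussianCentre_inl_castAdd (Z Z' : Fin (m + q) → ℂ) (i : Fin m) :
    polyEval₂ (gaussianCentre m q (.inl (Fin.castAdd q i))) Z Z' =
      (Z (Fin.castAdd q i) + (starRingEnd ℂ) (Z' (Fin.castAdd q i))) / 2 := by
  simp only [polyEval₂, gaussianCentre, Sum.elim_inl, Sum.elim_inr, Fin.addCases_left, realCoords,
    map_add, map_mul, MvPolynomial.eval_C, MvPolynomial.eval_X, conj_eq_re_sub_im]
  linear_combination (Complex.re_add_im (Z (Fin.castAdd q i))) / 2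

lemma polyEval₂_gaussianCentre_inr_castAdd (Z Z' : Fin (m + q) → ℂ) (i : Fin m) :
    polyEval₂ (gaussianCentre m q (.inr (Fin.castAdd q i))) Z Z' =
      Complex.I * ((starRingEnd ℂ) (Z' (Fin.castAdd q i)) - Z (Fin.castAdd q i)) / 2 := by
  simp only [polyEval₂, gaussianCentre, Sum.elim_inl, Sum.elim_inr, Fin.addCases_left, realCoords,
    map_add, map_mul, MvPolynomial.eval_C, MvPolynomial.eval_X, conj_eq_re_sub_im]
  linear_combination (-Complex.I / 2) * Complex.re_add_im (Z (Fin.castAdd q i))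
    + (((Z (Fin.castAdd q i)).im + (Z' (Fin.castAdd q i)).im) / 2 : ℂ) * Complex.I_sq

lemma polyEval₂_gaussianCentre_natAdd (Z Z' : Fin (m + q) → ℂ) (i : Fin q) :
    polyEval₂ (gaussianCentre m q (.inl (Fin.natAdd m i))) Z Z' = 0 ∧
      polyEval₂ (gaussianCentre m q (.inr (Fin.natAdd m i))) Z Z' = 0 := by
  simp [polyEval₂, gaussianCentre]

lemma ofReal_norm_sq (w : ℂ) : (‖w‖ : ℂ) ^ 2 = (w.re : ℂ) ^ 2 + (w.im : ℂ) ^ 2 := by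
  rw [← Complex.ofReal_pow, Complex.sq_norm, Complex.normSq_apply]
  push_cast
  ring

lemma modelOrthKernel0_mul (Z W Z' : Fin (m + q) → ℂ) :
    modelOrthKernel0 m q Z W * modelOrthKernel0 m q W Z' = modelOrthKernel0 m q Z Z' *
      ∏ j, Complex.exp (-π * (realCoords W j - polyEval₂ (gaussianCentre m q j) Z Z') ^ 2) := by
  rw [modelOrthKernel0, modelOrthKernel0, modelOrthKernel0, ← Complex.exp_sum, ← Complex.exp_add,
    ← Complex.exp_add, Fintype.sum_sum_type, ← Finset.sum_add_distrib, Fin.sum_univ_add]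
  congr 1
  have hN (i : Fin q) := polyEval₂_gaussianCentre_natAdd (m := m) Z Z' i
  simp only [polyEval₂_gaussianCentre_inl_castAdd, polyEval₂_gaussianCentre_inr_castAdd, hN,
    realCoords, Sum.elim_inl, Sum.elim_inr, sub_zero]
  simp only [mul_add, Finset.mul_sum]
  rw [add_add_add_comm, ← Finset.sum_add_distrib, ← Finset.sum_add_distrib, add_add_add_comm,
    ← Finset.sum_add_distrib, ← Finset.sum_add_distrib]
  congr 1 <;> refine Finset.sum_congr rfl fun i _ => ?_
  · generalize Fin.castAdd q i = j
    rw [ofReal_norm_sq (W j), conj_eq_re_sub_im (W j)]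
    linear_combination
      (π / 4 * ((starRingEnd ℂ) (Z' j) - Z j) ^ 2 : ℂ) * Complex.I_sq
        - π * (starRingEnd ℂ) (Z' j) * Complex.re_add_im (W j)
  · rw [ofReal_norm_sq (W _)]
    ring

lemma modelOrthKernel0_neg_neg (Z Z' : Fin (m + q) → ℂ) :
    modelOrthKernel0 m q (-Z) (-Z') = modelOrthKernel0 m q Z Z' := by
  simp [modelOrthKernel0]

lemma modelOrthKernel0_ne_zero (Z Z' : Fin (m + q) → ℂ) : modelOrthKernel0 m q Z Z' ≠ 0 :=
  Complex.exp_ne_zero _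

lemma polyEval₂_eq_sum {n k : ℕ} (A : MvPolynomial ((Fin n ⊕ Fin n) ⊕ (Fin k ⊕ Fin k)) ℂ)
    (Z : Fin n → ℂ) (Z' : Fin k → ℂ) :
    polyEval₂ A Z Z' = ∑ s ∈ A.support, A.coeff s *
      ((∏ j, realCoords Z j ^ s (.inl j)) * ∏ j, realCoords Z' j ^ s (.inr j)) := by
  rw [polyEval₂, MvPolynomial.eval_eq']
  simp only [Fintype.prod_sum_type (α₁ := Fin n ⊕ Fin n), Sum.elim_inl, Sum.elim_inr]

lemma polyEval₂_mul_kernel_eq_sum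
    (A₁ A₂ : MvPolynomial ((Fin (m + q) ⊕ Fin (m + q)) ⊕ (Fin (m + q) ⊕ Fin (m + q))) ℂ)
    (Z W Z' : Fin (m + q) → ℂ) :
    polyEval₂ A₁ Z W * modelOrthKernel0 m q Z W * (polyEval₂ A₂ W Z' * modelOrthKernel0 m q W Z')
      = ∑ s ∈ A₁.support, ∑ t ∈ A₂.support, modelOrthKernel0 m q Z Z' *
        (A₁.coeff s * A₂.coeff t *
          ((∏ j, realCoords Z j ^ s (.inl j)) * ∏ j, realCoords Z' j ^ t (.inr j))) *
        ∏ j, (realCoords W j ^ (s (.inr j) + t (.inl j)) *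
          Complex.exp (-π * (realCoords W j - polyEval₂ (gaussianCentre m q j) Z Z') ^ 2)) := by
  rw [mul_mul_mul_comm, modelOrthKernel0_mul, polyEval₂_eq_sum, polyEval₂_eq_sum,
    Finset.sum_mul_sum, Finset.sum_mul]
  refine Finset.sum_congr rfl fun s _ => ?_
  rw [Finset.sum_mul]
  refine Finset.sum_congr rfl fun t _ => ?_
  simp only [pow_add, Finset.prod_mul_distrib]
  ring

open MvPolynomial in
/-- The polynomial coefficient of the composition of the kernels `A₁ 𝒫^{⊥,0}` and
`A₂ 𝒫^{⊥,0}`. -/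
noncomputable def composedPoly
    (A₁ A₂ : MvPolynomial ((Fin (m + q) ⊕ Fin (m + q)) ⊕ (Fin (m + q) ⊕ Fin (m + q))) ℂ) :
    MvPolynomial ((Fin (m + q) ⊕ Fin (m + q)) ⊕ (Fin (m + q) ⊕ Fin (m + q))) ℂ :=
  ∑ s ∈ A₁.support, ∑ t ∈ A₂.support,
    C (A₁.coeff s * A₂.coeff t) *
      ((∏ j, X (.inl j) ^ s (.inl j)) * ∏ j, X (.inr j) ^ t (.inr j)) *
      ∏ j, gaussianMoment (gaussianCentre m q j) (s (.inr j) + t (.inl j))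

lemma polyEval₂_composedPoly
    (A₁ A₂ : MvPolynomial ((Fin (m + q) ⊕ Fin (m + q)) ⊕ (Fin (m + q) ⊕ Fin (m + q))) ℂ)
    (Z Z' : Fin (m + q) → ℂ) :
    polyEval₂ (composedPoly A₁ A₂) Z Z' = ∑ s ∈ A₁.support, ∑ t ∈ A₂.support,
      (A₁.coeff s * A₂.coeff t *
        ((∏ j, realCoords Z j ^ s (.inl j)) * ∏ j, realCoords Z' j ^ t (.inr j))) *
      ∏ j, gaussianMoment (polyEval₂ (gaussianCentre m q j) Z Z')
        (s (.inr j) + t (.inl j)) := by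
  have hmap (p : MvPolynomial ((Fin (m + q) ⊕ Fin (m + q)) ⊕ (Fin (m + q) ⊕ Fin (m + q))) ℂ)
      (k : ℕ) : MvPolynomial.eval (Sum.elim (realCoords Z) (realCoords Z')) (gaussianMoment p k)
        = gaussianMoment (polyEval₂ p Z Z') k := by
    simpa [MvPolynomial.coe_aeval_eq_eval, polyEval₂] using
      map_gaussianMoment (MvPolynomial.aeval (Sum.elim (realCoords Z) (realCoords Z'))) p k
  rw [polyEval₂, composedPoly]
  simp only [map_sum, map_mul, map_prod, map_pow, MvPolynomial.eval_C, MvPolynomial.eval_X, hmap,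
    Sum.elim_inl, Sum.elim_inr]

lemma totalDegree_composedPoly_le
    (A₁ A₂ : MvPolynomial ((Fin (m + q) ⊕ Fin (m + q)) ⊕ (Fin (m + q) ⊕ Fin (m + q))) ℂ) :
    (composedPoly A₁ A₂).totalDegree ≤ A₁.totalDegree + A₂.totalDegree := by
  refine MvPolynomial.totalDegree_finsetSum_le fun s hs =>
    MvPolynomial.totalDegree_finsetSum_le fun t ht => ?_
  have hs' := MvPolynomial.le_totalDegree hs
  have ht' := MvPolynomial.le_totalDegree ht
  rw [Finsupp.sum_fintype _ _ fun _ => rfl, Fintype.sum_sum_type] at hs' ht'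
  have hprod {κ : Type} (f : Fin (m + q) ⊕ Fin (m + q) → MvPolynomial κ ℂ)
      (d : Fin (m + q) ⊕ Fin (m + q) → ℕ) (h : ∀ j, (f j).totalDegree ≤ d j) :
      (∏ j, f j).totalDegree ≤ ∑ j, d j :=
    (MvPolynomial.totalDegree_finsetProd _ _).trans (Finset.sum_le_sum fun j _ => h j)
  have h₁ := hprod _ (fun j => s (.inl j)) fun j =>
    (MvPolynomial.totalDegree_X_pow (R := ℂ) (Sum.inl j : _ ⊕ (Fin (m + q) ⊕ Fin (m + q)))
      (s (.inl j))).le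
  have h₂ := hprod _ (fun j => t (.inr j)) fun j =>
    (MvPolynomial.totalDegree_X_pow (R := ℂ) (Sum.inr j : (Fin (m + q) ⊕ Fin (m + q)) ⊕ _)
      (t (.inr j))).le
  have h₃ := hprod _ (fun j => s (.inr j) + t (.inl j)) fun j =>
    totalDegree_gaussianMoment_le (totalDegree_gaussianCentre_le m q j) (s (.inr j) + t (.inl j))
  rw [Finset.sum_add_distrib] at h₃
  refine (MvPolynomial.totalDegree_mul _ _).trans ((add_le_add
    ((MvPolynomial.totalDegree_mul _ _).trans (add_le_add (MvPolynomial.totalDegree_C _).le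
      ((MvPolynomial.totalDegree_mul _ _).trans (add_le_add h₁ h₂)))) h₃).trans ?_)
  lia

lemma integrable_kernel_comp
    (A₁ A₂ : MvPolynomial ((Fin (m + q) ⊕ Fin (m + q)) ⊕ (Fin (m + q) ⊕ Fin (m + q))) ℂ)
    (Z Z' : Fin (m + q) → ℂ) :
    Integrable fun W : Fin (m + q) → ℂ =>
      polyEval₂ A₁ Z W * modelOrthKernel0 m q Z W
        * (polyEval₂ A₂ W Z' * modelOrthKernel0 m q W Z') := by
  simp_rw [polyEval₂_mul_kernel_eq_sum]
  exact integrable_finsetSum _ fun s _ => integrable_finsetSum _ fun t _ =>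
    (integrable_monomial_mul_gaussian _ _).const_mul _

lemma integral_kernel_comp
    (A₁ A₂ : MvPolynomial ((Fin (m + q) ⊕ Fin (m + q)) ⊕ (Fin (m + q) ⊕ Fin (m + q))) ℂ)
    (Z Z' : Fin (m + q) → ℂ) :
    ∫ W : Fin (m + q) → ℂ, polyEval₂ A₁ Z W * modelOrthKernel0 m q Z W
        * (polyEval₂ A₂ W Z' * modelOrthKernel0 m q W Z')
      = polyEval₂ (composedPoly A₁ A₂) Z Z' * modelOrthKernel0 m q Z Z' := by
  simp_rw [polyEval₂_mul_kernel_eq_sum]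
  have hint (s t : (Fin (m + q) ⊕ Fin (m + q)) ⊕ (Fin (m + q) ⊕ Fin (m + q)) →₀ ℕ) (a : ℂ) :=
    (integrable_monomial_mul_gaussian (fun j => polyEval₂ (gaussianCentre m q j) Z Z')
      fun j => s (.inr j) + t (.inl j)).const_mul a
  rw [integral_finsetSum _ fun s _ => integrable_finsetSum _ fun t _ => hint s t _,
    polyEval₂_composedPoly, Finset.sum_mul]
  refine Finset.sum_congr rfl fun s _ => ?_
  rw [integral_finsetSum _ fun t _ => hint s t _, Finset.sum_mul]
  refine Finset.sum_congr rfl fun t _ => ?_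
  rw [integral_const_mul, integral_monomial_mul_gaussian
    (fun j => polyEval₂ (gaussianCentre m q j) Z Z') fun j => s (.inr j) + t (.inl j)]
  ring

/-- Parity is inherited by the composition, with sign `ε₁ * ε₂`. -/
lemma polyEval₂_composedPoly_neg_neg
    {A₁ A₂ : MvPolynomial ((Fin (m + q) ⊕ Fin (m + q)) ⊕ (Fin (m + q) ⊕ Fin (m + q))) ℂ}
    {ε₁ ε₂ : ℂ} (h₁ : ∀ Z Z', polyEval₂ A₁ (-Z) (-Z') = ε₁ * polyEval₂ A₁ Z Z')
    (h₂ : ∀ Z Z', polyEval₂ A₂ (-Z) (-Z') = ε₂ * polyEval₂ A₂ Z Z') (Z Z' : Fin (m + q) → ℂ) :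
    polyEval₂ (composedPoly A₁ A₂) (-Z) (-Z')
      = ε₁ * ε₂ * polyEval₂ (composedPoly A₁ A₂) Z Z' := by
  apply mul_right_cancel₀ (modelOrthKernel0_ne_zero Z Z')
  rw [mul_assoc, ← integral_kernel_comp, ← integral_const_mul, ← modelOrthKernel0_neg_neg,
    ← integral_kernel_comp, ← integral_neg_eq_self]
  refine integral_congr_ae (Filter.Eventually.of_forall fun W => ?_)
  simp only [h₁, h₂, modelOrthKernel0_neg_neg]
  ring

end Centre

theorem statement8 (m q : ℕ)
    (A₁ A₂ : MvPolynomial ((Fin (m + q) ⊕ Fin (m + q)) ⊕ (Fin (m + q) ⊕ Fin (m + q))) ℂ) :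
    ∃ A₃ : MvPolynomial ((Fin (m + q) ⊕ Fin (m + q)) ⊕ (Fin (m + q) ⊕ Fin (m + q))) ℂ,
      A₃.totalDegree ≤ A₁.totalDegree + A₂.totalDegree ∧
      (∀ Z Z' : Fin (m + q) → ℂ,
        (Integrable (fun W : Fin (m + q) → ℂ =>
          polyEval₂ A₁ Z W * modelOrthKernel0 m q Z W
            * (polyEval₂ A₂ W Z' * modelOrthKernel0 m q W Z')) volume) ∧
        (∫ W : Fin (m + q) → ℂ,
            polyEval₂ A₁ Z W * modelOrthKernel0 m q Z W
              * (polyEval₂ A₂ W Z' * modelOrthKernel0 m q W Z'))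
          = polyEval₂ A₃ Z Z' * modelOrthKernel0 m q Z Z') ∧
      (((IsEvenPoly A₁ ∧ IsEvenPoly A₂) ∨ (IsOddPoly A₁ ∧ IsOddPoly A₂)) → IsEvenPoly A₃) ∧
      (((IsEvenPoly A₁ ∧ IsOddPoly A₂) ∨ (IsOddPoly A₁ ∧ IsEvenPoly A₂)) → IsOddPoly A₃) := by
  refine ⟨composedPoly A₁ A₂, totalDegree_composedPoly_le A₁ A₂, fun Z Z' =>
    ⟨integrable_kernel_comp A₁ A₂ Z Z', integral_kernel_comp A₁ A₂ Z Z'⟩, ?_, ?_⟩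
  · rintro (⟨h₁, h₂⟩ | ⟨h₁, h₂⟩) Z Z'
    · simpa using polyEval₂_composedPoly_neg_neg (ε₁ := 1) (ε₂ := 1)
        (by simpa only [one_mul, neg_one_mul] using! h₁)
        (by simpa only [one_mul, neg_one_mul] using! h₂) Z Z'
    · simpa using polyEval₂_composedPoly_neg_neg (ε₁ := -1) (ε₂ := -1)
        (by simpa only [one_mul, neg_one_mul] using! h₁)
        (by simpa only [one_mul, neg_one_mul] using! h₂) Z Z'
  · rintro (⟨h₁, h₂⟩ | ⟨h₁, h₂⟩) Z Z'
    · simpa using polyEval₂_composedPoly_neg_neg (ε₁ := 1) (ε₂ := -1)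
        (by simpa only [one_mul, neg_one_mul] using! h₁)
        (by simpa only [one_mul, neg_one_mul] using! h₂) Z Z'
    · simpa using polyEval₂_composedPoly_neg_neg (ε₁ := -1) (ε₂ := 1)
        (by simpa only [one_mul, neg_one_mul] using! h₁)
        (by simpa only [one_mul, neg_one_mul] using! h₂) Z Z'
end

section
/- Orthogonality of the model extension to higher-order jets: fix integers 0 ≤ m ≤ n, k ∈ ℕ, a multi-index β ∈ ℕ^{n−m} with |β| = k, and a polynomial q on ℂ^m. Let f : ℂⁿ → ℂ be holomorphic (complex Fréchet differentiable on all of ℂⁿ) with ∫_{ℂⁿ} |f(z)|² exp(−π|z|²) dV(z) < ∞, and suppose that for every z_Y ∈ ℂ^m the holomorphic function z_N ↦ f(z_Y, z_N) − q(z_Y)·z_N^β on ℂ^{n−m} has all derivatives of order ≤ k vanishing at z_N = 0. Then ∫_{ℂⁿ} f(z) · conj(q(z_Y)) · conj(z_N)^β · exp(−π|z|²) dV(z) = ∫_{ℂⁿ} |q(z_Y)|² · |z_N^β|² · exp(−π|z|²) dV(z), both integrands being integrable. -/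
open MeasureTheory
open scoped Real

section SeveralComplexVariables

variable {E : Type*} [NormedAddCommGroup E] [NormedSpace ℂ E]

/-- Cauchy's formula for directional derivatives of an entire function on a complex normed
space. -/
lemma fderiv_apply_eq_integral_circleMap {h : E → ℂ} (hh : Differentiable ℂ h) (z v : E) :
    fderiv ℂ h z v = (2 * π * Complex.I : ℂ)⁻¹ *
      ∫ θ in (0 : ℝ)..2 * π, (Complex.I * (circleMap 0 1 θ)⁻¹) * h (z + circleMap 0 1 θ • v) := by
  have hφ : Differentiable ℂ (fun t : ℂ => h (z + t • v)) := by fun_prop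
  have hderiv : deriv (fun t : ℂ => h (z + t • v)) 0 = fderiv ℂ h z v := by
    have h1 : HasDerivAt (fun t : ℂ => z + t • v) v 0 := by
      simpa using ((hasDerivAt_id (0 : ℂ)).smul_const v).const_add z
    have h2 : HasFDerivAt h (fderiv ℂ h z) (z + (0 : ℂ) • v) := by
      simpa using (hh z).hasFDerivAt
    exact (h2.comp_hasDerivAt (0 : ℂ) h1).deriv
  have hc := hφ.differentiableOn.deriv_eq_smul_circleIntegral (c := 0) (R := 1) one_pos
  rw [hderiv, circleIntegral] at hc
  rw [eq_inv_mul_iff_mul_eq₀ Complex.two_pi_I_ne_zero, ← smul_eq_mul, ← hc]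
  refine intervalIntegral.integral_congr fun θ _ => ?_
  have hne : circleMap 0 1 θ ≠ 0 := circleMap_ne_center one_ne_zero
  simp only [deriv_circleMap, smul_eq_mul, sub_zero]
  field_simp

variable [FiniteDimensional ℂ E]

lemma Differentiable.continuous_fderiv_of_complex {h : E → ℂ} (hh : Differentiable ℂ h) :
    Continuous (fderiv ℂ h) := by
  refine continuous_clm_apply.2 fun v => ?_
  simp_rw [fderiv_apply_eq_integral_circleMap hh]
  refine continuous_const.mul
    (intervalIntegral.continuous_parametric_intervalIntegral_of_continuous' ?_ _ _)
  have hc := hh.continuous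
  have hne : ∀ p : E × ℝ, circleMap 0 1 p.2 ≠ 0 := fun p => circleMap_ne_center one_ne_zero
  have hcm : Continuous (circleMap 0 1) := continuous_circleMap 0 1
  simp only [Function.uncurry_def]
  fun_prop (disch := exact hne)

lemma Differentiable.differentiable_fderiv_apply_of_complex {h : E → ℂ}
    (hh : Differentiable ℂ h) (v : E) : Differentiable ℂ (fun z => fderiv ℂ h z v) := by
  have := FiniteDimensional.proper ℂ E
  intro z₀
  have hc := hh.continuous
  have hcd := hh.continuous_fderiv_of_complex
  have hcm : Continuous (circleMap 0 1) := continuous_circleMap 0 1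
  have hne : ∀ θ : ℝ, circleMap 0 1 θ ≠ 0 := fun θ => circleMap_ne_center one_ne_zero
  simp_rw [fderiv_apply_eq_integral_circleMap hh,
    intervalIntegral.integral_of_le Real.two_pi_pos.le]
  refine DifferentiableAt.const_mul ?_ _
  obtain ⟨M, hM⟩ := (isCompact_closedBall z₀ (1 + ‖v‖)).exists_bound_of_continuousOn
    hcd.continuousOn
  have hint : ∀ {F : Type _} [NormedAddCommGroup F] {u : ℝ → F}, Continuous u →
      Integrable u (volume.restrict (Set.Ioc 0 (2 * π))) := fun hu =>
    (hu.integrableOn_Icc (a := 0) (b := 2 * π)).mono_set Set.Ioc_subset_Icc_self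
  refine (hasFDerivAt_integral_of_dominated_of_fderiv_le (𝕜 := ℂ) (bound := fun _ => M)
    (F' := fun z θ => (Complex.I * (circleMap 0 1 θ)⁻¹) •
      fderiv ℂ h (z + circleMap 0 1 θ • v))
    (Metric.ball_mem_nhds z₀ one_pos) ?_ ?_ ?_ ?_ ?_ ?_).differentiableAt
  · refine Filter.Eventually.of_forall fun z => Continuous.aestronglyMeasurable ?_
    fun_prop (disch := exact hne)
  · refine hint ?_
    fun_prop (disch := exact hne)
  · refine Continuous.aestronglyMeasurable ?_
    fun_prop (disch := exact hne)
  · refine Filter.Eventually.of_forall fun θ z hz => ?_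
    rw [norm_smul]
    have : z + circleMap 0 1 θ • v ∈ Metric.closedBall z₀ (1 + ‖v‖) := by
      rw [mem_closedBall_iff_norm, add_sub_right_comm]
      refine (norm_add_le _ _).trans (add_le_add (mem_ball_iff_norm.1 hz).le ?_)
      simp [norm_smul]
    simpa using hM _ this
  · exact integrable_const _
  · refine Filter.Eventually.of_forall fun θ z _ => ?_
    have h1 : HasFDerivAt (fun z => z + circleMap 0 1 θ • v) (ContinuousLinearMap.id ℂ E) z :=
      (hasFDerivAt_id z).add_const _
    simpa using ((hh _).hasFDerivAt.comp z h1).const_mul (Complex.I * (circleMap 0 1 θ)⁻¹)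

/-- An entire function on a finite-dimensional complex space is smooth. -/
lemma Differentiable.contDiff_of_complex {h : E → ℂ} (hh : Differentiable ℂ h) (n : ℕ) :
    ContDiff ℂ n h := by
  induction n generalizing h with
  | zero => exact_mod_cast contDiff_zero.2 hh.continuous
  | succ n ih =>
    push_cast
    exact contDiff_succ_iff_fderiv_apply.2
      ⟨hh, by simp, fun v => ih (hh.differentiable_fderiv_apply_of_complex v)⟩

/-- If the `k`-th derivative of an entire function vanishes at the origin, so does its `k`-th
Fourier coefficient along each circle `θ ↦ exp(iθ) w`. -/
lemma integral_circleMap_smul_eq_zero {h : E → ℂ} (hh : Differentiable ℂ h) {k : ℕ}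
    (hk : iteratedFDeriv ℂ k h 0 = 0) (w : E) :
    ∫ θ in (0 : ℝ)..2 * π, h (circleMap 0 1 θ • w) * ((circleMap 0 1 θ)⁻¹) ^ k = 0 := by
  have hφ : Differentiable ℂ (fun t : ℂ => h (t • w)) := by fun_prop
  have hderiv : iteratedDeriv k (fun t : ℂ => h (t • w)) 0 = 0 := by
    have := (ContinuousLinearMap.toSpanSingleton ℂ w).iteratedFDeriv_comp_right
      (hh.contDiff_of_complex k) 0 le_rfl
    rw [map_zero, hk] at this
    have h2 : iteratedFDeriv ℂ k (fun t : ℂ => h (t • w)) 0 = 0 := by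
      refine ContinuousMultilinearMap.ext fun x => ?_
      simpa [Function.comp_def] using congrArg (fun L => L x) this
    rw [iteratedDeriv, h2]
    rfl
  have hc := hφ.differentiableOn.circleIntegral_one_div_sub_center_pow_smul
    (c := 0) (R := 1) one_pos k
  rw [hderiv, smul_zero, circleIntegral] at hc
  have h3 : Complex.I * ∫ θ in (0 : ℝ)..2 * π,
      h (circleMap 0 1 θ • w) * ((circleMap 0 1 θ)⁻¹) ^ k = 0 := by
    refine Eq.trans ?_ hc
    rw [← intervalIntegral.integral_const_mul]
    refine intervalIntegral.integral_congr fun θ _ => ?_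
    have hne : circleMap 0 1 θ ≠ 0 := circleMap_ne_center one_ne_zero
    simp only [deriv_circleMap, smul_eq_mul, sub_zero, inv_pow]
    field_simp
    ring
  exact (mul_eq_zero.1 h3).resolve_left Complex.I_ne_zero

end SeveralComplexVariables

section Gaussian

lemma integrable_exp_neg_mul_sum_norm_sq {ι : Type*} [Fintype ι] {b : ℝ} (hb : 0 < b) :
    Integrable (fun z : ι → ℂ => Real.exp (-b * ∑ i, ‖z i‖ ^ 2)) := by
  have h1 : Integrable (fun w : ℂ => Real.exp (-b * ‖w‖ ^ 2)) := by
    have := (GaussianFourier.integrable_cexp_neg_mul_sq_norm_add (V := ℂ) (b := b)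
      (by simpa using hb) 0 0).norm
    refine this.congr (Filter.Eventually.of_forall fun w => ?_)
    simp [Complex.norm_exp, ← Complex.ofReal_pow]
  have h2 := Integrable.fintype_prod (ι := ι) (f := fun _ (w : ℂ) => Real.exp (-b * ‖w‖ ^ 2))
    (μ := fun _ => volume) fun _ => h1
  refine h2.congr (Filter.Eventually.of_forall fun z => ?_)
  simp [← Real.exp_sum, Finset.mul_sum]

lemma MvPolynomial.exists_norm_eval_le_exp {ι : Type*} [Fintype ι] (P : MvPolynomial ι ℂ)
    {ε : ℝ} (hε : 0 < ε) :
    ∃ C : ℝ, ∀ z : ι → ℂ, ‖MvPolynomial.eval z P‖ ≤ C * Real.exp (ε * ∑ i, ‖z i‖ ^ 2) := by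
  induction P using MvPolynomial.induction_on generalizing ε with
  | C a =>
    refine ⟨‖a‖, fun z => ?_⟩
    rw [MvPolynomial.eval_C]
    exact le_mul_of_one_le_right (norm_nonneg _) (Real.one_le_exp (by positivity))
  | add p q hp hq =>
    obtain ⟨A, hA⟩ := hp hε
    obtain ⟨B, hB⟩ := hq hε
    refine ⟨A + B, fun z => ?_⟩
    rw [map_add, add_mul]
    exact (norm_add_le _ _).trans (add_le_add (hA z) (hB z))
  | mul_X p i hp =>
    obtain ⟨A, hA⟩ := hp (half_pos hε)
    refine ⟨A * (1 + 2 / ε), fun z => ?_⟩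
    have hX : ‖z i‖ ≤ (1 + 2 / ε) * Real.exp (ε / 2 * ∑ i, ‖z i‖ ^ 2) := by
      have h1 : ‖z i‖ ^ 2 ≤ ∑ i, ‖z i‖ ^ 2 :=
        Finset.single_le_sum (f := fun i => ‖z i‖ ^ 2) (fun _ _ => by positivity)
          (Finset.mem_univ i)
      have h2 := Real.add_one_le_exp (ε / 2 * ∑ i, ‖z i‖ ^ 2)
      have h4 : ‖z i‖ ≤ (1 + 2 / ε) * (ε / 2 * ‖z i‖ ^ 2 + 1) := by
        have : (1 + 2 / ε) * (ε / 2 * ‖z i‖ ^ 2 + 1)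
            = ‖z i‖ ^ 2 + ε / 2 * ‖z i‖ ^ 2 + 1 + 2 / ε := by
          field_simp
          ring
        rw [this]
        have : 0 < 2 / ε := by positivity
        nlinarith [sq_nonneg (‖z i‖ - 1), mul_nonneg hε.le (sq_nonneg ‖z i‖)]
      refine h4.trans (mul_le_mul_of_nonneg_left (le_trans ?_ h2) (by positivity))
      gcongr
    rw [map_mul, MvPolynomial.eval_X, norm_mul]
    calc _ ≤ (A * Real.exp (ε / 2 * ∑ i, ‖z i‖ ^ 2)) *
          ((1 + 2 / ε) * Real.exp (ε / 2 * ∑ i, ‖z i‖ ^ 2)) :=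
        mul_le_mul (hA z) hX (norm_nonneg _) ((norm_nonneg _).trans (hA z))
      _ = _ := by
        rw [show ε * ∑ i, ‖z i‖ ^ 2 = ε / 2 * ∑ i, ‖z i‖ ^ 2 + ε / 2 * ∑ i, ‖z i‖ ^ 2 by ring,
          Real.exp_add]
        ring

lemma MvPolynomial.integrable_norm_eval_sq_mul_exp {ι : Type*} [Fintype ι]
    (P : MvPolynomial ι ℂ) {b : ℝ} (hb : 0 < b) :
    Integrable (fun z : ι → ℂ =>
      ‖MvPolynomial.eval z P‖ ^ 2 * Real.exp (-b * ∑ i, ‖z i‖ ^ 2)) := by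
  obtain ⟨C, hC⟩ := P.exists_norm_eval_le_exp (ε := b / 4) (by positivity)
  have hP : Continuous fun z => MvPolynomial.eval z P := P.continuous_eval
  refine ((integrable_exp_neg_mul_sum_norm_sq (ι := ι) (half_pos hb)).const_mul (C ^ 2)).mono'
    (Continuous.aestronglyMeasurable (by fun_prop)) (Filter.Eventually.of_forall fun z => ?_)
  rw [Real.norm_of_nonneg (by positivity)]
  calc _ ≤ (C * Real.exp (b / 4 * ∑ i, ‖z i‖ ^ 2)) ^ 2 * Real.exp (-b * ∑ i, ‖z i‖ ^ 2) := by
        gcongr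
        exact hC z
    _ = _ := by
        rw [mul_pow, ← Real.exp_nat_mul, mul_assoc, ← Real.exp_add]
        congr 2
        push_cast
        ring

lemma integrable_mul_conj_mul_of_sq {α : Type*} [MeasurableSpace α] {μ : Measure α}
    {f g : α → ℂ} {w : α → ℝ} (hw : ∀ x, 0 ≤ w x)
    (hm : AEStronglyMeasurable (fun x => f x * (starRingEnd ℂ) (g x) * (w x : ℂ)) μ)
    (hf : Integrable (fun x => ‖f x‖ ^ 2 * w x) μ)
    (hg : Integrable (fun x => ‖g x‖ ^ 2 * w x) μ) :
    Integrable (fun x => f x * (starRingEnd ℂ) (g x) * (w x : ℂ)) μ := by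
  refine (hf.add hg).mono' hm (Filter.Eventually.of_forall fun x => ?_)
  rw [norm_mul, norm_mul, RCLike.norm_conj, Complex.norm_real, Real.norm_of_nonneg (hw x),
    Pi.add_apply, ← add_mul]
  refine mul_le_mul_of_nonneg_right ?_ (hw x)
  nlinarith [sq_nonneg (‖f x‖ - ‖g x‖), sq_nonneg ‖f x‖, sq_nonneg ‖g x‖]

end Gaussian

section Rotation

/-- Multiplication of the last `d` coordinates by the scalar `u`. -/
def scaleLast {m d : ℕ} (u : ℂ) (z : Fin (m + d) → ℂ) : Fin (m + d) → ℂ :=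
  fun i => Fin.append (fun _ : Fin m => (1 : ℂ)) (fun _ : Fin d => u) i * z i

variable {m d : ℕ}

@[simp]
lemma scaleLast_castAdd (u : ℂ) (z : Fin (m + d) → ℂ) (i : Fin m) :
    scaleLast u z (Fin.castAdd d i) = z (Fin.castAdd d i) := by
  simp [scaleLast]

@[simp]
lemma scaleLast_natAdd (u : ℂ) (z : Fin (m + d) → ℂ) (t : Fin d) :
    scaleLast u z (Fin.natAdd m t) = u * z (Fin.natAdd m t) := by
  simp [scaleLast]

lemma scaleLast_eq_append (u : ℂ) (z : Fin (m + d) → ℂ) :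
    scaleLast u z = Fin.append (fun i => z (Fin.castAdd d i))
      (u • fun t => z (Fin.natAdd m t)) := by
  ext i
  refine Fin.addCases (fun i => ?_) (fun t => ?_) i <;> simp

lemma norm_append_one {u : ℂ} (hu : ‖u‖ = 1) (i : Fin (m + d)) :
    ‖Fin.append (fun _ : Fin m => (1 : ℂ)) (fun _ : Fin d => u) i‖ = 1 := by
  refine Fin.addCases (fun i => ?_) (fun t => ?_) i <;> simp [hu]

lemma norm_scaleLast_apply {u : ℂ} (hu : ‖u‖ = 1) (z : Fin (m + d) → ℂ) (i : Fin (m + d)) :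
    ‖scaleLast u z i‖ = ‖z i‖ := by
  rw [scaleLast, norm_mul, norm_append_one hu, one_mul]

lemma measurePreserving_scaleLast {u : ℂ} (hu : ‖u‖ = 1) :
    MeasurePreserving (scaleLast (m := m) (d := d) u) := by
  refine volume_preserving_pi fun i => ?_
  let a : Circle := ⟨Fin.append (fun _ : Fin m => (1 : ℂ)) (fun _ : Fin d => u) i,
    mem_sphere_zero_iff_norm.2 (norm_append_one hu i)⟩
  exact (rotation a).measurePreserving

lemma continuous_scaleLast_uncurry :
    Continuous (fun p : ℂ × (Fin (m + d) → ℂ) => scaleLast p.1 p.2) := by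
  refine continuous_pi fun i => ?_
  refine Fin.addCases (fun i => ?_) (fun t => ?_) i
  · simp only [scaleLast_castAdd]
    fun_prop
  · simp only [scaleLast_natAdd]
    fun_prop

/-- A continuous integrable function whose mean over almost every orbit of the circle action on the
last coordinates vanishes has integral zero. -/
lemma integral_eq_zero_of_circle_mean_eq_zero {G : (Fin (m + d) → ℂ) → ℂ} (hG : Continuous G)
    (hGi : Integrable G)
    (hmean : ∀ z, ∫ θ in (0 : ℝ)..2 * π, G (scaleLast (circleMap 0 1 θ) z) = 0) :
    ∫ z, G z = 0 := by
  have hu : ∀ θ : ℝ, ‖circleMap 0 1 θ‖ = 1 := fun θ => by simp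
  have hemb : ∀ θ : ℝ, Integrable (fun z : Fin (m + d) → ℂ =>
      G (scaleLast (circleMap 0 1 θ) z)) := fun θ =>
    (measurePreserving_scaleLast (hu θ)).integrable_comp_of_integrable hGi
  have hval : ∀ {F : Type} [NormedAddCommGroup F] [NormedSpace ℝ F]
      (H : (Fin (m + d) → ℂ) → F), Continuous H → ∀ θ : ℝ,
      ∫ z, H (scaleLast (circleMap 0 1 θ) z) = ∫ z, H z := fun H hH θ => by
    have h1 := measurePreserving_scaleLast (m := m) (d := d) (hu θ)
    have h2 := integral_map (μ := volume) h1.measurable.aemeasurable (f := H)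
      hH.aestronglyMeasurable
    rw [h1.map_eq] at h2
    exact h2.symm
  have hcont : Continuous (fun p : ℝ × (Fin (m + d) → ℂ) =>
      G (scaleLast (circleMap 0 1 p.1) p.2)) :=
    hG.comp (continuous_scaleLast_uncurry.comp
      (((continuous_circleMap 0 1).comp continuous_fst).prodMk continuous_snd))
  have hprod : Integrable (Function.uncurry fun (θ : ℝ) (z : Fin (m + d) → ℂ) =>
      G (scaleLast (circleMap 0 1 θ) z))
      ((volume.restrict (Set.Ioc 0 (2 * π))).prod volume) := by
    refine (integrable_prod_iff hcont.aestronglyMeasurable).2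
      ⟨Filter.Eventually.of_forall hemb, ?_⟩
    simp only
    simp_rw [hval (fun z => ‖G z‖) hG.norm]
    exact integrable_const _
  have hswap := integral_integral_swap hprod
  simp_rw [← intervalIntegral.integral_of_le Real.two_pi_pos.le, hmean, hval G hG] at hswap
  simpa [Real.pi_ne_zero] using hswap

end Rotation

theorem statement14 (m d k : ℕ) (β : Fin d → ℕ) (hβ : ∑ j, β j = k)
    (Q : MvPolynomial (Fin m) ℂ) (f : (Fin (m + d) → ℂ) → ℂ)
    (hf : Differentiable ℂ f)
    (hL2 : Integrable (fun z : Fin (m + d) → ℂ =>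
      ‖f z‖ ^ 2 * Real.exp (-π * ∑ i, ‖z i‖ ^ 2)) volume)
    (hjet : ∀ zY : Fin m → ℂ, ∀ j ≤ k,
      iteratedFDeriv ℂ j
        (fun zN : Fin d → ℂ =>
          f (Fin.append zY zN) - MvPolynomial.eval zY Q * ∏ t, zN t ^ β t)
        0 = 0) :
    (Integrable (fun z : Fin (m + d) → ℂ =>
        f z * (starRingEnd ℂ) (MvPolynomial.eval (fun i => z (Fin.castAdd d i)) Q)
          * (∏ t, (starRingEnd ℂ) (z (Fin.natAdd m t)) ^ β t)
          * (Real.exp (-π * ∑ i, ‖z i‖ ^ 2) : ℂ)) volume) ∧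
    (Integrable (fun z : Fin (m + d) → ℂ =>
        ‖MvPolynomial.eval (fun i => z (Fin.castAdd d i)) Q‖ ^ 2
          * ‖∏ t, z (Fin.natAdd m t) ^ β t‖ ^ 2
          * Real.exp (-π * ∑ i, ‖z i‖ ^ 2)) volume) ∧
    (∫ z : Fin (m + d) → ℂ,
        f z * (starRingEnd ℂ) (MvPolynomial.eval (fun i => z (Fin.castAdd d i)) Q)
          * (∏ t, (starRingEnd ℂ) (z (Fin.natAdd m t)) ^ β t)
          * (Real.exp (-π * ∑ i, ‖z i‖ ^ 2) : ℂ)) =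
      ((∫ z : Fin (m + d) → ℂ,
          ‖MvPolynomial.eval (fun i => z (Fin.castAdd d i)) Q‖ ^ 2
            * ‖∏ t, z (Fin.natAdd m t) ^ β t‖ ^ 2
            * Real.exp (-π * ∑ i, ‖z i‖ ^ 2) : ℝ) : ℂ) := by
  set P : MvPolynomial (Fin (m + d)) ℂ :=
    MvPolynomial.rename (Fin.castAdd d) Q * ∏ t, MvPolynomial.X (Fin.natAdd m t) ^ β t with hP
  have hPe : ∀ z, MvPolynomial.eval z P =
      MvPolynomial.eval (fun i => z (Fin.castAdd d i)) Q * ∏ t, z (Fin.natAdd m t) ^ β t :=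
    fun z => by simp [hP, MvPolynomial.eval_rename, Function.comp_def]
  have hPi := P.integrable_norm_eval_sq_mul_exp Real.pi_pos
  have hPd : Differentiable ℂ fun z => MvPolynomial.eval z P := fun z =>
    (AnalyticOnNhd.eval_mvPolynomial P z (Set.mem_univ z)).differentiableAt
  have hPc := hPd.continuous
  have hfc := hf.continuous
  have hf_int := integrable_mul_conj_mul_of_sq (g := fun z => MvPolynomial.eval z P)
    (w := fun z : Fin (m + d) → ℂ => Real.exp (-π * ∑ i, ‖z i‖ ^ 2))
    (fun z => (Real.exp_pos _).le)
    (Continuous.aestronglyMeasurable (by fun_prop)) hL2 hPi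
  have hP_int := integrable_mul_conj_mul_of_sq (f := fun z => MvPolynomial.eval z P)
    (g := fun z => MvPolynomial.eval z P)
    (w := fun z : Fin (m + d) → ℂ => Real.exp (-π * ∑ i, ‖z i‖ ^ 2))
    (fun z => (Real.exp_pos _).le)
    (Continuous.aestronglyMeasurable (by fun_prop)) hPi hPi
  have hortho : ∫ z : Fin (m + d) → ℂ, (f z - MvPolynomial.eval z P) *
      (starRingEnd ℂ) (MvPolynomial.eval z P) *
      (Real.exp (-π * ∑ i, ‖z i‖ ^ 2) : ℂ) = 0 := by
    refine integral_eq_zero_of_circle_mean_eq_zero (by fun_prop)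
      ((hf_int.sub hP_int).congr (Filter.Eventually.of_forall fun z => ?_)) fun z => ?_
    · simp only [Pi.sub_apply]
      ring
    · set zY : Fin m → ℂ := fun i => z (Fin.castAdd d i) with hzY
      set zN : Fin d → ℂ := fun t => z (Fin.natAdd m t) with hzN
      have hap : Differentiable ℂ fun zN : Fin d → ℂ => Fin.append zY zN := by
        refine differentiable_pi.2 fun i => ?_
        refine Fin.addCases (fun i => ?_) (fun t => ?_) i
        · simp only [Fin.append_left]
          fun_prop
        · simp only [Fin.append_right]
          fun_prop
      have hh : Differentiable ℂ (fun zN : Fin d → ℂ =>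
          f (Fin.append zY zN) - MvPolynomial.eval zY Q * ∏ t, zN t ^ β t) := by
        have := hf.comp hap
        refine this.sub (Differentiable.const_mul ?_ _)
        fun_prop
      have hzero := integral_circleMap_smul_eq_zero hh (hjet zY k le_rfl) zN
      refine Eq.trans ?_ ((congrArg (· * ((starRingEnd ℂ) (MvPolynomial.eval z P) *
        (Real.exp (-π * ∑ i, ‖z i‖ ^ 2) : ℂ))) hzero).trans (zero_mul _))
      simp only [← intervalIntegral.integral_mul_const]
      refine intervalIntegral.integral_congr fun θ _ => ?_
      have hu : ‖circleMap 0 1 θ‖ = 1 := by simp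
      have hinv : (starRingEnd ℂ) (circleMap 0 1 θ) = (circleMap 0 1 θ)⁻¹ :=
        (Complex.inv_eq_conj hu).symm
      have hPu : MvPolynomial.eval (scaleLast (circleMap 0 1 θ) z) P =
          circleMap 0 1 θ ^ k * MvPolynomial.eval z P := by
        simp only [hPe, scaleLast_castAdd, scaleLast_natAdd, mul_pow, Finset.prod_mul_distrib,
          Finset.prod_pow_eq_pow_sum, hβ]
        ring
      have hg : f (scaleLast (circleMap 0 1 θ) z) -
          MvPolynomial.eval (scaleLast (circleMap 0 1 θ) z) P =
          f (Fin.append zY (circleMap 0 1 θ • zN)) -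
            MvPolynomial.eval zY Q * ∏ t, (circleMap 0 1 θ • zN) t ^ β t := by
        rw [hPe, scaleLast_eq_append]
        simp [hzY, hzN]
      simp only [norm_scaleLast_apply hu]
      rw [hg, hPu, map_mul, map_pow, hinv]
      ring
  have e1 : (fun z : Fin (m + d) → ℂ =>
        f z * (starRingEnd ℂ) (MvPolynomial.eval (fun i => z (Fin.castAdd d i)) Q)
          * (∏ t, (starRingEnd ℂ) (z (Fin.natAdd m t)) ^ β t)
          * (Real.exp (-π * ∑ i, ‖z i‖ ^ 2) : ℂ)) = fun z =>
      f z * (starRingEnd ℂ) (MvPolynomial.eval z P) *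
        (Real.exp (-π * ∑ i, ‖z i‖ ^ 2) : ℂ) := by
    ext z
    simp [hPe, mul_assoc]
  have e2 : (fun z : Fin (m + d) → ℂ =>
        ‖MvPolynomial.eval (fun i => z (Fin.castAdd d i)) Q‖ ^ 2
          * ‖∏ t, z (Fin.natAdd m t) ^ β t‖ ^ 2
          * Real.exp (-π * ∑ i, ‖z i‖ ^ 2)) = fun z =>
      ‖MvPolynomial.eval z P‖ ^ 2 * Real.exp (-π * ∑ i, ‖z i‖ ^ 2) := by
    ext z
    rw [hPe, norm_mul, mul_pow]
  rw [e1, e2]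
  refine ⟨hf_int, hPi, ?_⟩
  simp only [sub_mul] at hortho
  rw [integral_sub hf_int hP_int, sub_eq_zero] at hortho
  rw [hortho, ← integral_complex_ofReal]
  refine integral_congr_ae (Filter.Eventually.of_forall fun z => ?_)
  simp [Complex.mul_conj']
end
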